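/- arXiv:2410.18704 — 9 statements merged into one kernel-verified Lean document; each statement's English description precedes it below -/
import Mathlib

section
/- There exist constants C > 0 and c ≥ 0 such that for every integer n ≥ 2 and every finite vertex set V with |V| = n, there is a deterministic cut-query decision tree over V of depth at most C·n^{5/3}·(log n)^c which, for every finite simple graph G on V, when run on G outputs a set S with ∅ ≠ S ≠ V whose boundary size |∂_G S| equals the minimum of |∂_G T| over all T with ∅ ≠ T ≠ V (i.e., the tree computes a global minimum cut of G). -/
/-- A deterministic cut-query decision tree over the vertex set `V` with
outputs in `α`: either a leaf labeled by an output value, or an internal node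
labeled by a query set `Q ⊆ V` together with a child tree for every possible
answer `a ∈ ℕ`. -/
inductive CutQueryTree (V : Type) (α : Type) : Type
  | leaf : α → CutQueryTree V α
  | node : Finset V → (ℕ → CutQueryTree V α) → CutQueryTree V α

namespace CutQueryTree

/-- Running a cut-query decision tree against an answer oracle
`ans : Finset V → ℕ`: at an internal node labeled `Q` we move to the child
indexed by `ans Q`; the output is the label of the leaf reached. -/
def run {V α : Type} : CutQueryTree V α → (Finset V → ℕ) → α
  | leaf a, _ => a
  | node Q child, ans => (child (ans Q)).run ans

/-- `DepthLE T d`: every root-to-leaf path of `T` passes through at most `d`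
internal nodes (i.e. the tree makes at most `d` queries). -/
inductive DepthLE {V α : Type} : CutQueryTree V α → ℕ → Prop
  | leaf (a : α) (d : ℕ) : DepthLE (leaf a) d
  | node (Q : Finset V) (child : ℕ → CutQueryTree V α) (d : ℕ)
      (h : ∀ a : ℕ, DepthLE (child a) d) : DepthLE (node Q child) (d + 1)

end CutQueryTree

/-- The number of edges of the simple graph `G` with exactly one endpoint in `S`
(each boundary edge is counted once, via its orientation from `S` to `Sᶜ`). -/
def cutCard {V : Type*} [Fintype V] [DecidableEq V] (G : SimpleGraph V)
    [DecidableRel G.Adj] (S : Finset V) : ℕ :=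
  (Finset.univ.filter (fun p : V × V => p.1 ∈ S ∧ p.2 ∉ S ∧ G.Adj p.1 p.2)).card

namespace CutQueryTree

section Trees

variable {V α β : Type}

/-- Sequential composition of decision trees. -/
def bind : CutQueryTree V α → (α → CutQueryTree V β) → CutQueryTree V β
  | leaf a, k => k a
  | node Q child, k => node Q (fun i => (child i).bind k)

theorem bind_run (T : CutQueryTree V α) (k : α → CutQueryTree V β) (ans : Finset V → ℕ) :
    (T.bind k).run ans = (k (T.run ans)).run ans := by
  induction T with
  | leaf a => rfl
  | node Q child ih => exact ih _

theorem DepthLE.mono {T : CutQueryTree V α} {d e : ℕ} (h : DepthLE T d) (hde : d ≤ e) :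
    DepthLE T e := by
  induction h generalizing e with
  | leaf a d => exact DepthLE.leaf a e
  | node Q child d _ ih =>
    obtain ⟨e, rfl⟩ : ∃ e', e = e' + 1 := ⟨e - 1, by omega⟩
    exact DepthLE.node Q child e fun a => ih a (by omega)

theorem DepthLE.bind {T : CutQueryTree V α} {k : α → CutQueryTree V β} {d e : ℕ}
    (h : DepthLE T d) (hk : ∀ a, DepthLE (k a) e) : DepthLE (T.bind k) (d + e) := by
  induction h with
  | leaf a d => exact (hk a).mono (by omega)
  | node Q child d _ ih =>
    rw [Nat.add_right_comm]
    exact DepthLE.node Q _ _ ih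

end Trees

end CutQueryTree

namespace CutQuery

open Finset

section EdgeCounts

variable {V : Type}

open Classical in
/-- The adjacency indicator of a graph, as a natural number. -/
noncomputable def adjInd (G : SimpleGraph V) (u v : V) : ℕ := if G.Adj u v then 1 else 0

theorem adjInd_congr {G H : SimpleGraph V} {u v u' v' : V} (h : G.Adj u v ↔ H.Adj u' v') :
    adjInd G u v = adjInd H u' v' := by
  by_cases hH : H.Adj u' v'
  · simp [adjInd, hH, h.mpr hH]
  · simp [adjInd, hH, mt h.mp hH]

theorem adjInd_comm (G : SimpleGraph V) (u v : V) : adjInd G u v = adjInd G v u :=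
  adjInd_congr (G.adj_comm u v)

@[simp] theorem adjInd_self (G : SimpleGraph V) (u : V) : adjInd G u u = 0 := by simp [adjInd]

theorem adjInd_le_one (G : SimpleGraph V) (u v : V) : adjInd G u v ≤ 1 := by
  unfold adjInd; split <;> simp

theorem adjInd_eq_one {G : SimpleGraph V} {u v : V} : adjInd G u v = 1 ↔ G.Adj u v := by
  simp [adjInd]

theorem adjInd_mono {G H : SimpleGraph V} (h : H ≤ G) (u v : V) : adjInd H u v ≤ adjInd G u v := by
  unfold adjInd
  by_cases huv : H.Adj u v
  · simp [huv, h huv]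
  · simp [huv]

/-- The number of pairs in `A × B` joined by an edge. -/
noncomputable def edgeCount (G : SimpleGraph V) (A B : Finset V) : ℕ :=
  ∑ a ∈ A, ∑ b ∈ B, adjInd G a b

theorem edgeCount_comm (G : SimpleGraph V) (A B : Finset V) :
    edgeCount G A B = edgeCount G B A := by
  unfold edgeCount
  rw [sum_comm]
  simp only [adjInd_comm]

theorem edgeCount_singleton (G : SimpleGraph V) (a b : V) :
    edgeCount G {a} {b} = adjInd G a b := by
  simp [edgeCount]

theorem edgeCount_mono_left (G : SimpleGraph V) {A A' : Finset V} (B : Finset V) (h : A ⊆ A') :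
    edgeCount G A B ≤ edgeCount G A' B :=
  sum_le_sum_of_subset h

theorem edgeCount_mono (G : SimpleGraph V) {A A' B B' : Finset V} (hA : A ⊆ A') (hB : B ⊆ B') :
    edgeCount G A B ≤ edgeCount G A' B' := by
  refine (edgeCount_mono_left G B hA).trans ?_
  rw [edgeCount_comm, edgeCount_comm G A' B']
  exact edgeCount_mono_left G A' hB

theorem edgeCount_mono_graph {G H : SimpleGraph V} (h : H ≤ G) (A B : Finset V) :
    edgeCount H A B ≤ edgeCount G A B :=
  sum_le_sum fun a _ => sum_le_sum fun b _ => adjInd_mono h a b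

/-- The degree of a vertex. -/
noncomputable def deg [Fintype V] (G : SimpleGraph V) (w : V) : ℕ := ∑ u, adjInd G w u

theorem deg_eq_edgeCount [Fintype V] (G : SimpleGraph V) (w : V) :
    deg G w = edgeCount G {w} univ := by
  simp [deg, edgeCount]

theorem edgeCount_le_mul (G : SimpleGraph V) (A B : Finset V) : edgeCount G A B ≤ #A * #B := by
  rw [← smul_eq_mul]
  refine sum_le_card_nsmul _ _ _ fun a _ => ?_
  simpa using sum_le_card_nsmul B _ 1 fun b _ => adjInd_le_one G a b

theorem card_mul_le_edgeCount_univ [Fintype V] {G : SimpleGraph V} {δ : ℕ} (hδ : ∀ w, δ ≤ deg G w)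
    (U : Finset V) : #U * δ ≤ edgeCount G U univ := by
  rw [← smul_eq_mul]
  exact card_nsmul_le_sum _ _ _ fun a _ => hδ a

variable [DecidableEq V]

theorem edgeCount_union_left (G : SimpleGraph V) {A B : Finset V} (C : Finset V)
    (h : Disjoint A B) : edgeCount G (A ∪ B) C = edgeCount G A C + edgeCount G B C :=
  sum_union h

theorem edgeCount_union_right (G : SimpleGraph V) {A B : Finset V} (C : Finset V)
    (h : Disjoint A B) : edgeCount G C (A ∪ B) = edgeCount G C A + edgeCount G C B := by
  rw [edgeCount_comm, edgeCount_union_left G C h, edgeCount_comm G A, edgeCount_comm G B]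

theorem edgeCount_union_self (G : SimpleGraph V) {A B : Finset V} (h : Disjoint A B) :
    edgeCount G (A ∪ B) (A ∪ B) =
      edgeCount G A A + edgeCount G B B + 2 * edgeCount G A B := by
  rw [edgeCount_union_left G _ h, edgeCount_union_right G _ h, edgeCount_union_right G _ h,
    edgeCount_comm G B A]
  ring

theorem edgeCount_singleton_erase (G : SimpleGraph V) (w : V) (A : Finset V) :
    edgeCount G {w} (A.erase w) = edgeCount G {w} A := by
  simp only [edgeCount, sum_singleton]
  exact sum_erase _ (adjInd_self G w)

variable [Fintype V]

/-- The number of edges leaving `S`. -/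
noncomputable def cut (G : SimpleGraph V) (S : Finset V) : ℕ := edgeCount G S Sᶜ

theorem cutCard_eq_cut (G : SimpleGraph V) [DecidableRel G.Adj] (S : Finset V) :
    cutCard G S = cut G S := by
  trans #((S ×ˢ Sᶜ).filter fun p => G.Adj p.1 p.2)
  · unfold cutCard
    congr 1
    ext p
    simp [and_assoc]
  · rw [card_filter, cut, edgeCount, ← sum_product']
    exact sum_congr rfl fun p _ => by by_cases h : G.Adj p.1 p.2 <;> simp [adjInd, h]

theorem cut_compl (G : SimpleGraph V) (S : Finset V) : cut G Sᶜ = cut G S := by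
  unfold cut
  rw [compl_compl, edgeCount_comm]

theorem cut_add_cut (G : SimpleGraph V) {A B : Finset V} (h : Disjoint A B) :
    cut G A + cut G B = cut G (A ∪ B) + 2 * edgeCount G A B := by
  have hA : Aᶜ = B ∪ (A ∪ B)ᶜ := by
    ext v
    have : v ∈ A → v ∉ B := fun hv => disjoint_left.mp h hv
    simp only [mem_compl, mem_union]
    tauto
  have hB : Bᶜ = A ∪ (A ∪ B)ᶜ := by
    ext v
    have : v ∈ A → v ∉ B := fun hv => disjoint_left.mp h hv
    simp only [mem_compl, mem_union]
    tauto
  have dA : Disjoint A (A ∪ B)ᶜ := disjoint_compl_right.mono_left subset_union_left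
  have dB : Disjoint B (A ∪ B)ᶜ := disjoint_compl_right.mono_left subset_union_right
  have h1 : cut G A = edgeCount G A B + edgeCount G A (A ∪ B)ᶜ := by
    rw [cut, hA, edgeCount_union_right G _ dB]
  have h2 : cut G B = edgeCount G A B + edgeCount G B (A ∪ B)ᶜ := by
    rw [cut, hB, edgeCount_union_right G _ dA, edgeCount_comm G B A]
  rw [h1, h2, cut, edgeCount_union_left G _ h]
  ring

theorem edgeCount_univ (G : SimpleGraph V) (S : Finset V) :
    edgeCount G univ univ = edgeCount G S S + edgeCount G Sᶜ Sᶜ + 2 * cut G S := by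
  rw [← union_compl S, edgeCount_union_self G disjoint_compl_right, cut]

theorem cut_singleton (G : SimpleGraph V) (w : V) : cut G {w} = deg G w := by
  rw [deg_eq_edgeCount, ← edgeCount_singleton_erase, cut]
  congr 1
  ext
  simp

end EdgeCounts

section Solves

variable {V α β : Type} [Fintype V] [DecidableEq V]

/-- Some cut-query decision tree of depth at most `d` outputs, on every graph `G`, a value
related to `G` by `P`. -/
def Solves (d : ℕ) (P : SimpleGraph V → α → Prop) : Prop :=
  ∃ T : CutQueryTree V α, T.DepthLE d ∧ ∀ G, P G (T.run (cut G))

theorem Solves.pure {P : SimpleGraph V → α → Prop} (a : α) (h : ∀ G, P G a) (d : ℕ) :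
    Solves d P :=
  ⟨.leaf a, .leaf a d, h⟩

theorem Solves.mono {P : SimpleGraph V → α → Prop} {d e : ℕ} (h : Solves d P) (hde : d ≤ e) :
    Solves e P := by
  obtain ⟨T, hT, hP⟩ := h
  exact ⟨T, hT.mono hde, hP⟩

theorem Solves.bind {P : SimpleGraph V → α → Prop} {Q : SimpleGraph V → β → Prop} {d e : ℕ}
    (hP : Solves d P) (hQ : ∀ a, Solves e (fun G b => P G a → Q G b)) : Solves (d + e) Q := by
  obtain ⟨T, hT, hTP⟩ := hP
  choose k hk hkQ using hQ
  refine ⟨T.bind k, hT.bind hk, fun G => ?_⟩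
  rw [CutQueryTree.bind_run]
  exact hkQ _ G (hTP G)

theorem Solves.weaken {P Q : SimpleGraph V → α → Prop} {d : ℕ} (hP : Solves d P)
    (h : ∀ G a, P G a → Q G a) : Solves d Q := by
  obtain ⟨T, hT, hTP⟩ := hP
  exact ⟨T, hT, fun G => h _ _ (hTP G)⟩

theorem solves_query (Q : Finset V) : Solves 1 (fun G (a : ℕ) => a = cut G Q) :=
  ⟨.node Q .leaf, .node Q _ 0 fun a => .leaf a 0, fun _ => rfl⟩

theorem solves_cut_values (Qs : Finset (Finset V)) :
    Solves #Qs (fun G (a : Finset V → ℕ) => ∀ Q ∈ Qs, a Q = cut G Q) := by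
  induction Qs using Finset.induction with
  | empty => exact .pure 0 (by simp) _
  | insert Q Qs hQ ih =>
    rw [card_insert_of_notMem hQ]
    refine ih.bind fun a => Nat.zero_add 1 ▸ ?_
    rw [Nat.add_comm]
    refine (solves_query Q).bind fun c => .pure (Function.update a Q c) (fun G hc ha => ?_) 0
    intro R hR
    by_cases h : R = Q
    · simp [h, hc]
    · rw [Function.update_of_ne h]
      exact ha R ((mem_insert.mp hR).resolve_left h)

/-- Querying a family of sets yields a surrogate graph with the same cut values on that family. -/
theorem solves_agree (Qs : Finset (Finset V)) :
    Solves #Qs (fun G (G' : SimpleGraph V) => ∀ Q ∈ Qs, cut G' Q = cut G Q) := by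
  classical
  refine Nat.add_zero #Qs ▸ (solves_cut_values Qs).bind fun a => ?_
  by_cases h : ∃ G' : SimpleGraph V, ∀ Q ∈ Qs, a Q = cut G' Q
  · obtain ⟨G', hG'⟩ := h
    exact .pure G' (fun G ha Q hQ => by rw [← hG' Q hQ, ha Q hQ]) 0
  · exact .pure ⊥ (fun G ha => absurd ⟨G, ha⟩ h) 0

theorem solves_agree_edgeCount (Ps : Finset (Finset V × Finset V)) :
    Solves (3 * #Ps) (fun G (G' : SimpleGraph V) =>
      ∀ P ∈ Ps, Disjoint P.1 P.2 → edgeCount G' P.1 P.2 = edgeCount G P.1 P.2) := by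
  refine ((solves_agree (Ps.image (fun P => P.1) ∪ Ps.image (fun P => P.2) ∪
    Ps.image (fun P => P.1 ∪ P.2))).weaken fun G G' h P hP hd => ?_).mono ?_
  · have h1 := h P.1 (by simp only [mem_union, mem_image]; exact .inl (.inl ⟨P, hP, rfl⟩))
    have h2 := h P.2 (by simp only [mem_union, mem_image]; exact .inl (.inr ⟨P, hP, rfl⟩))
    have h3 := h (P.1 ∪ P.2) (by
      rw [mem_union, mem_image (f := fun P : Finset V × Finset V => P.1 ∪ P.2)]
      exact .inr ⟨P, hP, rfl⟩)
    have h4 := cut_add_cut G hd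
    have h5 := cut_add_cut G' hd
    omega
  · have h1 := card_union_le (Ps.image (fun P => P.1) ∪ Ps.image (fun P => P.2))
      (Ps.image (fun P => P.1 ∪ P.2))
    have h2 := card_union_le (Ps.image (fun P => P.1)) (Ps.image (fun P => P.2))
    have h3 := card_image_le (s := Ps) (f := fun P => P.1)
    have h4 := card_image_le (s := Ps) (f := fun P => P.2)
    have h5 := card_image_le (s := Ps) (f := fun P => P.1 ∪ P.2)
    omega

theorem solves_forall_lt {P : ℕ → SimpleGraph V → α → Prop} {d : ℕ} [Nonempty α] (t : ℕ)
    (h : ∀ j < t, Solves d (P j)) :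
    Solves (t * d) (fun G (a : ℕ → α) => ∀ j < t, P j G (a j)) := by
  induction t with
  | zero => exact .pure (fun _ => Classical.arbitrary α) (by simp) _
  | succ t ih =>
    rw [Nat.succ_mul]
    refine (ih fun j hj => h j (by omega)).bind fun a => Nat.add_zero d ▸
      (h t (by omega)).bind fun b => .pure (Function.update a t b) (fun G hb ha j hj => ?_) 0
    by_cases hjt : j = t
    · subst hjt; simpa using hb
    · rw [Function.update_of_ne hjt]
      exact ha j (by omega)

end Solves

theorem singleton_ne_univ {V : Type} [Fintype V] (hV : 2 ≤ Fintype.card V) (v : V) :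
    ({v} : Finset V) ≠ univ := by
  intro h
  have := congrArg card h
  rw [card_singleton, card_univ] at this
  omega

section Sparse

variable {V : Type} [DecidableEq V]

/-- Every induced subgraph on at least two vertices has a cut with at most `δ` edges. -/
def IsSparse (δ : ℕ) (H : SimpleGraph V) : Prop :=
  ∀ U : Finset V, 2 ≤ #U →
    ∃ A ⊆ U, A.Nonempty ∧ (U \ A).Nonempty ∧ edgeCount H A (U \ A) ≤ δ

theorem IsSparse.edgeCount_le {δ : ℕ} {H : SimpleGraph V} (h : IsSparse δ H) (U : Finset V)
    (hU : U.Nonempty) : edgeCount H U U + 2 * δ ≤ 2 * δ * #U := by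
  induction U using Finset.strongInduction with
  | H U ih =>
    rcases Nat.lt_or_ge #U 2 with h1 | h2
    · obtain ⟨u, rfl⟩ := card_eq_one.mp (show #U = 1 by have := hU.card_pos; omega)
      simp [edgeCount]
    · obtain ⟨A, hAU, hA, hB, hle⟩ := h U h2
      have hAss : A ⊂ U := by
        refine hAU.ssubset_of_ne ?_
        rintro rfl
        simp at hB
      have iA := ih A hAss hA
      have iB := ih (U \ A) (sdiff_ssubset hAU hA) hB
      have hs := edgeCount_union_self H (A := A) (B := U \ A) disjoint_sdiff
      rw [union_sdiff_of_subset hAU] at hs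
      have hc := card_sdiff_add_card_eq_card hAU
      rw [← hc]
      rw [Nat.mul_add]
      omega

theorem isSparse_bot (δ : ℕ) : IsSparse δ (⊥ : SimpleGraph V) := by
  intro U hU
  obtain ⟨u, hu⟩ : U.Nonempty := card_pos.mp (by omega)
  refine ⟨{u}, singleton_subset_iff.mpr hu, singleton_nonempty u, ?_, ?_⟩
  · rw [← card_pos, card_sdiff_of_subset (singleton_subset_iff.mpr hu), card_singleton]
    omega
  · simp [edgeCount, adjInd]

end Sparse

section SparseCertificate

variable {V : Type} [Fintype V] [DecidableEq V]

/-- `S` is a global minimum cut of `G`. -/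
def IsMinCut (G : SimpleGraph V) (S : Finset V) : Prop :=
  S ≠ ∅ ∧ S ≠ univ ∧ ∀ T : Finset V, T ≠ ∅ → T ≠ univ → cut G S ≤ cut G T

theorem exists_isMinCut (hV : 2 ≤ Fintype.card V) (G : SimpleGraph V) :
    ∃ S, IsMinCut G S := by
  have : Nonempty V := Fintype.card_pos_iff.mp (by omega)
  obtain ⟨S, hS, hmin⟩ := exists_min_image
    ({S | S ≠ ∅ ∧ S ≠ univ} : Finset (Finset V)) (cut G)
    ⟨{Classical.arbitrary V}, by simp [singleton_ne_univ hV]⟩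
  simp only [mem_filter, mem_univ, true_and] at hS hmin
  exact ⟨S, hS.1, hS.2, fun T h1 h2 => hmin T ⟨h1, h2⟩⟩

/-- Halving search for a vertex of `A` that has more edges to `B` in `G` than in `H`. -/
theorem solves_bisect [Nonempty V] (H : SimpleGraph V) (B : Finset V) (p : ℕ) (A : Finset V)
    (hd : Disjoint A B) (hA : #A ≤ 2 ^ p) :
    Solves (3 * p) (fun G (a : V) => edgeCount H A B < edgeCount G A B →
      a ∈ A ∧ edgeCount H {a} B < edgeCount G {a} B) := by
  induction p generalizing A with
  | zero =>
    rcases Nat.le_one_iff_eq_zero_or_eq_one.mp hA with h | h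
    · rw [card_eq_zero] at h
      subst h
      exact .pure (Classical.arbitrary V) (by simp [edgeCount]) _
    · obtain ⟨a, rfl⟩ := card_eq_one.mp h
      exact .pure a (fun G h => ⟨mem_singleton_self a, h⟩) _
  | succ p ih =>
    obtain ⟨A₁, hA₁, hc⟩ := exists_subset_card_eq (s := A) (n := min #A (2 ^ p)) (by omega)
    have hc₂ : #(A \ A₁) ≤ 2 ^ p := by
      rw [card_sdiff_of_subset hA₁]
      rw [pow_succ] at hA
      omega
    have hsplit : ∀ K, edgeCount K A B = edgeCount K A₁ B + edgeCount K (A \ A₁) B := fun K => by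
      rw [← edgeCount_union_left K B disjoint_sdiff, union_sdiff_of_subset hA₁]
    have hd₁ := hd.mono_left hA₁
    have hstep := solves_agree_edgeCount {(A₁, B)}
    rw [card_singleton] at hstep
    rw [Nat.mul_succ, Nat.add_comm]
    refine hstep.bind fun G' => ?_
    by_cases hlt : edgeCount H A₁ B < edgeCount G' A₁ B
    · refine (ih A₁ hd₁ (by omega)).weaken fun G a h hG' hG => ?_
      rw [hG' (A₁, B) (mem_singleton_self _) hd₁] at hlt
      exact ⟨hA₁ (h hlt).1, (h hlt).2⟩
    · refine (ih (A \ A₁) (hd.mono_left sdiff_subset) hc₂).weaken fun G a h hG' hG => ?_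
      rw [hG' (A₁, B) (mem_singleton_self _) hd₁] at hlt
      dsimp only at hlt
      have := h (by have := hsplit G; have := hsplit H; omega)
      exact ⟨sdiff_subset this.1, this.2⟩

/-- Search for an edge of `G` between `A` and `B` that is not an edge of `H`. -/
theorem solves_new_edge [Nonempty V] (H : SimpleGraph V) (p : ℕ) (A B : Finset V)
    (hd : Disjoint A B) (hV : Fintype.card V ≤ 2 ^ p) :
    Solves (3 * p + 3 * p) (fun G (e : V × V) => edgeCount H A B < edgeCount G A B →
      e.1 ∈ A ∧ e.2 ∈ B ∧ G.Adj e.1 e.2 ∧ ¬ H.Adj e.1 e.2) := by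
  refine (solves_bisect H B p A hd ((card_le_univ A).trans hV)).bind fun a => ?_
  by_cases ha : a ∈ A
  · have hdB : Disjoint B {a} :=
      disjoint_singleton_right.mpr fun h => disjoint_left.mp hd ha h
    rw [← Nat.add_zero (3 * p)]
    refine (solves_bisect H {a} p B hdB ((card_le_univ B).trans hV)).bind fun b =>
      .pure (a, b) (fun G hb hG hlt => ?_) 0
    obtain ⟨hbB, hab⟩ := hb (by
      rw [edgeCount_comm H, edgeCount_comm G]
      exact (hG hlt).2)
    rw [edgeCount_singleton, edgeCount_singleton, adjInd_comm H, adjInd_comm G] at hab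
    have h1 := adjInd_le_one G a b
    refine ⟨ha, hbB, adjInd_eq_one.mp (show adjInd G a b = 1 by omega), fun h => ?_⟩
    have : adjInd H a b = 1 := adjInd_eq_one.mpr h
    omega
  · exact .pure (a, a) (fun G hG hlt => absurd (hG hlt).1 ha) _

theorem cut_sup_edge_le (H : SimpleGraph V) {S : Finset V} {u v : V} (hu : u ∈ S) (hv : v ∉ S) :
    cut (H ⊔ SimpleGraph.edge u v) S ≤ cut H S + 1 := by
  have hle : ∀ a ∈ S, ∀ b ∈ Sᶜ, adjInd (H ⊔ SimpleGraph.edge u v) a b ≤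
      adjInd H a b + if a = u then (if b = v then 1 else 0) else 0 := by
    intro a ha b hb
    rw [mem_compl] at hb
    by_cases hab : H.Adj a b
    · rw [adjInd_eq_one.mpr hab]
      exact (adjInd_le_one _ a b).trans (Nat.le_add_right _ _)
    · by_cases he : a = u ∧ b = v
      · rw [if_pos he.1, if_pos he.2]
        exact (adjInd_le_one _ a b).trans (Nat.le_add_left _ _)
      · have hnot : ¬ (a = v ∧ b = u) := fun h => hb (h.2 ▸ hu)
        have : ¬ (H ⊔ SimpleGraph.edge u v).Adj a b := by
          rw [SimpleGraph.sup_adj, SimpleGraph.edge_adj]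
          tauto
        simp [adjInd, this]
  calc cut (H ⊔ SimpleGraph.edge u v) S
      ≤ ∑ a ∈ S, ∑ b ∈ Sᶜ, (adjInd H a b + if a = u then (if b = v then 1 else 0) else 0) :=
        sum_le_sum fun a ha => sum_le_sum fun b hb => hle a ha b hb
    _ ≤ cut H S + 1 := by
        simp only [sum_add_distrib]
        refine Nat.add_le_add_left ?_ _
        rw [sum_comm]
        simp [hu, hv]

theorem cut_lt_cut_sup_edge (H : SimpleGraph V) {S : Finset V} {u v : V} (hu : u ∈ S)
    (hv : v ∉ S) (h : ¬ H.Adj u v) : cut H S < cut (H ⊔ SimpleGraph.edge u v) S := by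
  refine sum_lt_sum (fun a _ => sum_le_sum fun b _ => adjInd_mono le_sup_left a b)
    ⟨u, hu, sum_lt_sum (fun b _ => adjInd_mono le_sup_left u b) ⟨v, mem_compl.mpr hv, ?_⟩⟩
  have huv : (H ⊔ SimpleGraph.edge u v).Adj u v := by
    rw [SimpleGraph.sup_adj, SimpleGraph.edge_adj]
    exact .inr ⟨.inl ⟨rfl, rfl⟩, fun e => hv (e ▸ hu)⟩
  rw [adjInd_eq_one.mpr huv]
  simp [adjInd, h]

theorem IsSparse.sup_edge {δ : ℕ} {H : SimpleGraph V} (h : IsSparse δ H) {S : Finset V} {u v : V}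
    (hu : u ∈ S) (hv : v ∉ S) (hS : cut H S < δ) : IsSparse δ (H ⊔ SimpleGraph.edge u v) := by
  intro U hU
  by_cases huv : u ∈ U ∧ v ∈ U
  · refine ⟨U ∩ S, inter_subset_left, ⟨u, mem_inter.mpr ⟨huv.1, hu⟩⟩,
      ⟨v, by simp [huv.2, hv]⟩, ?_⟩
    calc edgeCount (H ⊔ SimpleGraph.edge u v) (U ∩ S) (U \ (U ∩ S))
        ≤ cut (H ⊔ SimpleGraph.edge u v) S := by
          refine edgeCount_mono _ inter_subset_right fun a ha => ?_
          simp only [mem_sdiff, mem_inter, not_and] at ha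
          exact mem_compl.mpr (ha.2 ha.1)
      _ ≤ δ := (cut_sup_edge_le H hu hv).trans hS
  · obtain ⟨A, hAU, hA, hB, hle⟩ := h U hU
    refine ⟨A, hAU, hA, hB, le_trans (le_of_eq ?_) hle⟩
    refine sum_congr rfl fun a ha => sum_congr rfl fun b hb => ?_
    have haU := hAU ha
    have hbU := sdiff_subset hb
    refine adjInd_congr ?_
    rw [SimpleGraph.sup_adj, SimpleGraph.edge_adj, or_iff_left]
    rintro ⟨⟨rfl, rfl⟩ | ⟨rfl, rfl⟩, -⟩ <;> tauto

/-- Growing a known subgraph `H` by one edge across its current minimum cut finds a minimum cut of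
`G` when some singleton cut has at most `δ` edges. -/
theorem solves_grow (hV : 2 ≤ Fintype.card V) {p : ℕ} (hp : Fintype.card V ≤ 2 ^ p) (v₀ : V)
    (δ N : ℕ) (H : SimpleGraph V) (hH : IsSparse δ H)
    (hN : 2 * δ * Fintype.card V < edgeCount H univ univ + 2 * N + 2 * δ) :
    Solves (N * (6 * p + 1)) (fun G (S : Finset V) => H ≤ G → cut G {v₀} ≤ δ → IsMinCut G S) := by
  have : Nonempty V := ⟨v₀⟩
  induction N generalizing H with
  | zero =>
    have := hH.edgeCount_le univ univ_nonempty
    rw [card_univ] at this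
    omega
  | succ N ih =>
    obtain ⟨S, hS1, hS2, hS⟩ := exists_isMinCut hV H
    rcases Nat.lt_or_ge (cut H S) δ with hlt | hge
    swap
    · refine .pure {v₀} (fun G hHG hδ => ⟨singleton_ne_empty v₀, singleton_ne_univ hV v₀,
        fun T h1 h2 => ?_⟩) _
      exact (hδ.trans hge).trans ((hS T h1 h2).trans (edgeCount_mono_graph hHG _ _))
    have hstep := solves_agree ({S} : Finset (Finset V))
    rw [card_singleton] at hstep
    rw [show (N + 1) * (6 * p + 1) = 1 + ((3 * p + 3 * p) + N * (6 * p + 1)) by ring]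
    refine hstep.bind fun G' => ?_
    by_cases hcut : cut G' S ≤ cut H S
    · refine .pure S (fun G hG hHG _ => ⟨hS1, hS2, fun T h1 h2 => ?_⟩) _
      rw [hG S (mem_singleton_self S)] at hcut
      exact hcut.trans ((hS T h1 h2).trans (edgeCount_mono_graph hHG _ _))
    refine (solves_new_edge H p S Sᶜ disjoint_compl_right hp).bind fun e => ?_
    by_cases he : e.1 ∈ S ∧ e.2 ∈ Sᶜ ∧ ¬ H.Adj e.1 e.2
    · obtain ⟨he1, he2, he3⟩ := he
      rw [mem_compl] at he2
      have hlt' := cut_lt_cut_sup_edge H he1 he2 he3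
      have hu1 := edgeCount_univ H S
      have hu2 := edgeCount_univ (H ⊔ SimpleGraph.edge e.1 e.2) S
      have hm1 := edgeCount_mono_graph (le_sup_left (a := H) (b := SimpleGraph.edge e.1 e.2)) S S
      have hm2 := edgeCount_mono_graph (le_sup_left (a := H) (b := SimpleGraph.edge e.1 e.2)) Sᶜ Sᶜ
      refine (ih _ (hH.sup_edge he1 he2 hlt) (by omega)).weaken fun G T hT he hG hHG hδ =>
        hT (sup_le hHG ?_) hδ
      obtain ⟨-, -, hadj, -⟩ := he (by
        rw [hG S (mem_singleton_self S)] at hcut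
        exact not_le.mp hcut)
      intro a b hab
      rw [SimpleGraph.edge_adj] at hab
      obtain ⟨⟨rfl, rfl⟩ | ⟨rfl, rfl⟩, -⟩ := hab
      · exact hadj
      · exact hadj.symm
    · refine .pure S (fun G he' hG hHG _ => absurd ?_ he) _
      obtain ⟨h1, h2, -, h3⟩ := he' (by
        rw [hG S (mem_singleton_self S)] at hcut
        exact not_le.mp hcut)
      exact ⟨h1, h2, h3⟩

theorem solves_isMinCut_of_small_degree (hV : 2 ≤ Fintype.card V) {p : ℕ}
    (hp : Fintype.card V ≤ 2 ^ p) (v₀ : V) (δ : ℕ) :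
    Solves ((δ * Fintype.card V + 1) * (6 * p + 1))
      (fun G (S : Finset V) => cut G {v₀} ≤ δ → IsMinCut G S) :=
  (solves_grow hV hp v₀ δ _ ⊥ (isSparse_bot δ) (by ring_nf; omega)).weaken
    fun _ _ h hδ => h bot_le hδ

end SparseCertificate

section StarForests

variable {V : Type} [Fintype V] [DecidableEq V]

theorem exists_vertex_edgeCount_ge [Nonempty V] {G : SimpleGraph V} {δ : ℕ}
    (hδ : ∀ w, δ ≤ deg G w) {W : Finset V} (hW : 2 * #W ≤ δ) (U : Finset V) :
    ∃ v ∉ W, #U * δ ≤ 2 * Fintype.card V * edgeCount G {v} U := by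
  by_contra! hcon
  have hn : 0 < Fintype.card V := Fintype.card_pos
  have hδn : δ ≤ Fintype.card V := by
    refine (hδ (Classical.arbitrary V)).trans ?_
    rw [deg_eq_edgeCount]
    simpa using edgeCount_le_mul G {Classical.arbitrary V} univ
  have hWc : Wᶜ.Nonempty := by
    rw [← card_pos, card_compl]
    omega
  have hup : 2 * Fintype.card V * edgeCount G Wᶜ U < #Wᶜ * (#U * δ) := by
    rw [edgeCount, mul_sum, ← smul_eq_mul (a := #Wᶜ), ← sum_const]
    refine sum_lt_sum_of_nonempty hWc fun v hv => ?_
    simpa [edgeCount] using hcon v (mem_compl.mp hv)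
  have h1 := card_mul_le_edgeCount_univ hδ U
  rw [← union_compl W, edgeCount_union_right G U disjoint_compl_right] at h1
  have h2 := edgeCount_le_mul G U W
  have h3 : #U * (2 * #W) ≤ #U * δ := Nat.mul_le_mul_left _ hW
  have h4 : #U * δ ≤ 2 * edgeCount G Wᶜ U := by
    rw [edgeCount_comm G Wᶜ]
    linarith
  have h5 : #Wᶜ * (#U * δ) ≤ Fintype.card V * (2 * edgeCount G Wᶜ U) :=
    Nat.mul_le_mul (card_le_univ _) h4
  linarith

/-- Greedily build a set `R` of `r` centres avoiding `W`, together with an assignment of adjacent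
centres to all vertices outside a geometrically small set `U`. -/
theorem solves_dominate [Nonempty V] (W : Finset V) (δ r : ℕ) :
    Solves (r * (6 * Fintype.card V)) (fun G (s : (V → V) × Finset V × Finset V) =>
      (∀ w, δ ≤ deg G w) → 2 * #W ≤ δ →
        (∀ w ∉ s.2.2, G.Adj w (s.1 w) ∧ s.1 w ∈ s.2.1) ∧ Disjoint s.2.1 W ∧ #s.2.1 ≤ r ∧
          #s.2.2 * (2 * Fintype.card V) ^ r ≤
            Fintype.card V * (2 * Fintype.card V - δ) ^ r) := by
  classical
  induction r with
  | zero => exact .pure (id, ∅, univ) (by simp) _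
  | succ r ih =>
    rw [Nat.succ_mul, show 6 * Fintype.card V = 3 * Fintype.card V + 3 * Fintype.card V by ring]
    rw [show 6 * Fintype.card V = 3 * Fintype.card V + 3 * Fintype.card V by ring] at ih
    refine ih.bind fun s => ?_
    obtain ⟨f, R, U⟩ := s
    have hstep := fun F : V → Finset V × Finset V => (solves_agree_edgeCount (univ.image F)).mono
      (Nat.mul_le_mul_left 3 (card_image_le.trans (card_univ (α := V)).le))
    refine (hstep fun v => ({v}, U.erase v)).bind fun G₁ => ?_
    have hG₁ : ∀ G : SimpleGraph V, (∀ P ∈ univ.image (fun v => (({v} : Finset V), U.erase v)),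
        Disjoint P.1 P.2 → edgeCount G₁ P.1 P.2 = edgeCount G P.1 P.2) →
        ∀ v, edgeCount G₁ {v} U = edgeCount G {v} U := by
      intro G h v
      rw [← edgeCount_singleton_erase G₁, ← edgeCount_singleton_erase G]
      exact h _ (mem_image_of_mem _ (mem_univ v)) (by simp)
    by_cases hv : ∃ v ∉ W, #U * δ ≤ 2 * Fintype.card V * edgeCount G₁ {v} U
    swap
    · refine .pure (f, R, U) (fun G hG _ hδ hW => absurd ?_ hv) _
      simp only [hG₁ G hG]
      exact exists_vertex_edgeCount_ge hδ hW U
    obtain ⟨v, hvW, hvU⟩ := hv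
    rw [← Nat.add_zero (3 * Fintype.card V)]
    refine (hstep fun u => ({v}, {u})).bind fun G₂ => .pure
      (fun w => if w ∈ U then v else f w, insert v R, U.filter fun w => ¬ (G₂.Adj w v ∧ w ≠ v))
      (fun G hG₂ hG hs hδ hW => ?_) 0
    have hadj : ∀ u, (G₂.Adj u v ∧ u ≠ v) ↔ G.Adj u v := by
      intro u
      by_cases huv : u = v
      · simp [huv]
      · have := hG₂ _ (mem_image_of_mem _ (mem_univ u)) (by simpa using Ne.symm huv)
        rw [edgeCount_singleton, edgeCount_singleton] at this
        rw [← adjInd_eq_one (G := G), adjInd_comm, ← this, adjInd_comm, adjInd_eq_one]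
        exact and_iff_left huv
    simp only [hadj]
    obtain ⟨h1, h2, h3, h4⟩ := hs hδ hW
    dsimp only at h1 h2 h3 h4
    refine ⟨fun w hw => ?_, ?_, (card_insert_le _ _).trans (by omega), ?_⟩
    · by_cases hwU : w ∈ U
      · simp only [hwU, if_true, mem_insert, true_or, and_true]
        by_contra hn
        exact hw (mem_filter.mpr ⟨hwU, hn⟩)
      · simp only [hwU, if_false]
        exact ⟨(h1 w hwU).1, mem_insert_of_mem (h1 w hwU).2⟩
    · exact disjoint_insert_left.mpr ⟨hvW, h2⟩
    · have hcount : edgeCount G {v} U = #(U.filter fun w => G.Adj w v) := by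
        rw [card_filter, edgeCount, sum_singleton]
        refine sum_congr rfl fun u _ => ?_
        rw [adjInd_comm]
        by_cases h : G.Adj u v <;> simp [adjInd, h]
      have hsum := card_filter_add_card_filter_not (s := U) (fun w => G.Adj w v)
      rw [hG₁ G hG, hcount] at hvU
      set a := #(U.filter fun w => G.Adj w v)
      set b := #(U.filter fun w => ¬ G.Adj w v)
      set n := Fintype.card V
      have hb : b * (2 * n) ≤ #U * (2 * n - δ) := by
        rw [Nat.mul_sub]
        apply Nat.le_sub_of_add_le
        rw [← hsum] at hvU ⊢
        linarith
      calc b * (2 * n) ^ (r + 1) = b * (2 * n) * (2 * n) ^ r := by ring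
        _ ≤ #U * (2 * n - δ) * (2 * n) ^ r := Nat.mul_le_mul_right _ hb
        _ = #U * (2 * n) ^ r * (2 * n - δ) := by ring
        _ ≤ n * (2 * n - δ) ^ r * (2 * n - δ) := Nat.mul_le_mul_right _ h4
        _ = n * (2 * n - δ) ^ (r + 1) := by ring

/-- Find `t` pairwise edge-disjoint (up to orientation) spanning star forests, each with at most
`k` centres. -/
theorem solves_star_forests [Nonempty V] (δ k t : ℕ)
    (hk : Fintype.card V * (2 * Fintype.card V - δ) ^ k < (2 * Fintype.card V) ^ k) :
    Solves (t * (k * (6 * Fintype.card V))) (fun G (F : ℕ → V → V) =>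
      (∀ w, δ ≤ deg G w) → 2 * (t * k) ≤ δ →
        (∀ j < t, ∀ w, G.Adj w (F j w)) ∧ (∀ j < t, #(univ.image (F j)) ≤ k) ∧
          ∀ j < t, ∀ i < j, ∀ w, F i w ≠ F j w) := by
  induction t with
  | zero => exact .pure (fun _ => id) (by simp) _
  | succ t ih =>
    rw [Nat.succ_mul]
    refine ih.bind fun F => ?_
    rw [← Nat.add_zero (k * _)]
    refine (solves_dominate ((range t).biUnion fun j => univ.image (F j)) δ k).bind fun s =>
      .pure (Function.update F t s.1) (fun G hs hF hδ htk => ?_) 0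
    have htk' : 2 * (t * k) ≤ δ :=
      (Nat.mul_le_mul_left 2 (Nat.mul_le_mul_right k (Nat.le_succ t))).trans htk
    obtain ⟨h1, h2, h3⟩ := hF hδ htk'
    obtain ⟨g1, g2, g3, g4⟩ := hs hδ (by
      have : #((range t).biUnion fun j => univ.image (F j)) ≤ #(range t) * k :=
        card_biUnion_le_card_mul _ _ _ fun j hj => h2 j (mem_range.mp hj)
      rw [card_range] at this
      omega)
    have hU : s.2.2 = ∅ := by
      by_contra hne
      have := card_pos.mpr (nonempty_iff_ne_empty.mpr hne)
      have := Nat.le_mul_of_pos_left ((2 * Fintype.card V) ^ k) this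
      omega
    have g1' : ∀ w, G.Adj w (s.1 w) ∧ s.1 w ∈ s.2.1 := fun w => g1 w (by simp [hU])
    refine ⟨fun j hj => ?_, fun j hj => ?_, fun j hj i hij w => ?_⟩
    · by_cases hjt : j = t
      · subst hjt
        simpa using fun w => (g1' w).1
      · rw [Function.update_of_ne hjt]
        exact h1 j (by omega)
    · by_cases hjt : j = t
      · subst hjt
        rw [Function.update_self]
        refine (card_le_card fun v hv => ?_).trans g3
        obtain ⟨w, -, rfl⟩ := mem_image.mp hv
        exact (g1' w).2
      · rw [Function.update_of_ne hjt]
        exact h2 j (by omega)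
    · rw [Function.update_of_ne (by omega : i ≠ t)]
      by_cases hjt : j = t
      · subst hjt
        rw [Function.update_self]
        intro h
        refine disjoint_left.mp g2 (g1' w).2 (mem_biUnion.mpr ⟨i, mem_range.mpr hij, ?_⟩)
        rw [← h]
        exact mem_image_of_mem _ (mem_univ w)
      · rw [Function.update_of_ne hjt]
        exact h3 j (by omega) i hij w

end StarForests

section Contraction

variable {V ι : Type}

/-- A family of two-colourings of `ι` has a subfamily with at most `|ι|` members that separates the
same pairs of points. -/
theorem exists_separating_subfamily [Fintype ι] (F : Set (ι → Bool)) :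
    ∃ B : Finset (ι → Bool), ↑B ⊆ F ∧ #B ≤ Fintype.card ι ∧
      ∀ i j, (∀ σ ∈ B, σ i = σ j) → ∀ σ ∈ F, σ i = σ j := by
  classical
  let φ : (ι → Bool) → ι → ℚ := fun σ i => if σ i then 1 else 0
  have hφ : ∀ σ i j, φ σ i = φ σ j ↔ σ i = σ j := by
    intro σ i j
    cases hi : σ i <;> cases hj : σ j <;> simp [φ, hi, hj]
  obtain ⟨b, hbF, hspan, hli⟩ := exists_linearIndependent ℚ (φ '' F)
  obtain ⟨B, hBF, rfl⟩ := Set.subset_image_iff.mp hbF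
  have hBfin : B.Finite := B.toFinite
  have hinj : Function.Injective φ := by
    intro σ τ h
    ext i
    have := congrFun h i
    cases hi : σ i <;> cases hj : τ i <;> simp [φ, hi, hj] at this ⊢
  refine ⟨hBfin.toFinset, by simpa using hBF, ?_, fun i j hij σ hσ => ?_⟩
  · have hli' : LinearIndependent ℚ (fun σ : hBfin.toFinset => φ σ) :=
      hli.comp (fun σ : hBfin.toFinset =>
          (⟨φ σ.1, Set.mem_image_of_mem φ (hBfin.mem_toFinset.mp σ.2)⟩ : φ '' B))
        fun σ τ h => Subtype.ext (hinj (Subtype.ext_iff.mp h))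
    have := hli'.fintype_card_le_finrank
    rwa [Fintype.card_coe, Module.finrank_fintype_fun_eq_card] at this
  · rw [← hφ]
    have hmem : φ σ ∈ Submodule.span ℚ (φ '' B) := by
      rw [hspan]
      exact Submodule.subset_span (Set.mem_image_of_mem φ hσ)
    generalize φ σ = y at hmem
    induction hmem using Submodule.span_induction with
    | mem y hy =>
      obtain ⟨τ, hτ, rfl⟩ := hy
      exact (hφ τ i j).mpr (hij τ (hBfin.mem_toFinset.mpr hτ))
    | zero => rfl
    | add y z _ _ hy hz => simp [hy, hz]
    | smul c y _ hy => simp [hy]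

/-- The number of neighbours of `w` coloured differently from `w` by `τ`. -/
noncomputable def opp [Fintype V] (G : SimpleGraph V) (τ : V → Bool) (w : V) : ℕ :=
  ∑ u, if τ u = τ w then 0 else adjInd G w u

theorem opp_le_opp_add [Fintype V] (G : SimpleGraph V) (τ τ' : V → Bool) {w : V} (hw : τ w = τ' w) :
    opp G τ w ≤ opp G τ' w + #{v | τ v ≠ τ' v} := by
  rw [opp, opp, card_filter, ← sum_add_distrib]
  refine sum_le_sum fun u _ => ?_
  have := adjInd_le_one G w u
  by_cases hu : τ u = τ' u
  · simp [hu, hw]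
  · simp only [ne_eq, hu, not_false_eq_true, if_true]
    split <;> split <;> omega

theorem sum_mul_adjInd_eq [Fintype V] [Fintype ι] [DecidableEq ι] (G : SimpleGraph V) (f : V → ι)
    (g : ι → ℕ) (w : V) :
    ∑ u, g (f u) * adjInd G w u = ∑ i, g i * edgeCount G {w} (univ.filter (f · = i)) := by
  rw [← sum_fiberwise univ f]
  refine sum_congr rfl fun i _ => ?_
  rw [edgeCount, sum_singleton, mul_sum]
  refine sum_congr rfl fun u hu => ?_
  rw [(mem_filter.mp hu).2]

/-- `G` and `H` have the same number of edges from every vertex to every fibre of `f`. -/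
def FiberAgree [Fintype V] [DecidableEq ι] (f : V → ι) (G H : SimpleGraph V) : Prop :=
  ∀ w i, edgeCount G {w} (univ.filter (f · = i)) = edgeCount H {w} (univ.filter (f · = i))

namespace FiberAgree

variable [Fintype V] [Fintype ι] [DecidableEq ι] {f : V → ι} {G H : SimpleGraph V}

theorem sum_eq (h : FiberAgree f G H) (g : ι → ℕ) (w : V) :
    ∑ u, g (f u) * adjInd G w u = ∑ u, g (f u) * adjInd H w u := by
  rw [sum_mul_adjInd_eq, sum_mul_adjInd_eq]
  exact sum_congr rfl fun i _ => by rw [h w i]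

theorem deg_eq (h : FiberAgree f G H) (w : V) : deg G w = deg H w := by
  simpa [deg] using h.sum_eq (fun _ => 1) w

theorem opp_eq (h : FiberAgree f G H) (σ : ι → Bool) (w : V) :
    opp G (σ ∘ f) w = opp H (σ ∘ f) w := by
  simpa [opp] using h.sum_eq (fun i => if σ i = σ (f w) then 0 else 1) w

end FiberAgree

variable [DecidableEq V]

/-- The two-colouring given by membership in `S`. -/
def side (S : Finset V) (v : V) : Bool := decide (v ∈ S)

theorem side_eq_side {S : Finset V} {u v : V} : side S u = side S v ↔ (u ∈ S ↔ v ∈ S) := by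
  simp [side]

variable [Fintype V]

theorem opp_side_compl (G : SimpleGraph V) (S : Finset V) (w : V) :
    opp G (side Sᶜ) w = opp G (side S) w := by
  unfold opp
  refine sum_congr rfl fun u _ => ?_
  simp only [side_eq_side, mem_compl, not_iff_not]

theorem opp_side_of_mem (G : SimpleGraph V) {S : Finset V} {w : V} (hw : w ∈ S) :
    opp G (side S) w = edgeCount G {w} Sᶜ := by
  rw [edgeCount, sum_singleton, opp, ← sum_filter_add_sum_filter_not univ (· ∈ S)]
  rw [sum_eq_zero, zero_add]
  · refine sum_congr (by ext; simp) fun u hu => ?_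
    rw [if_neg]
    rw [side_eq_side]
    simp_all
  · intro u hu
    rw [if_pos]
    rw [side_eq_side]
    simp_all

theorem sum_opp_side (G : SimpleGraph V) (S : Finset V) :
    ∑ w, opp G (side S) w = 2 * cut G S := by
  have h : ∀ S : Finset V, ∑ w ∈ S, opp G (side S) w = cut G S := fun S =>
    sum_congr rfl fun w hw => by rw [opp_side_of_mem G hw, edgeCount, sum_singleton]
  have h' := h Sᶜ
  simp only [opp_side_compl] at h'
  rw [← sum_add_sum_compl S, h, h', cut_compl]
  ring

theorem IsMinCut.compl {G : SimpleGraph V} {S : Finset V} (h : IsMinCut G S) :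
    IsMinCut G Sᶜ :=
  ⟨fun e => h.2.1 (compl_eq_empty_iff S |>.mp e), fun e => h.1 (compl_eq_univ_iff S |>.mp e),
    by rw [cut_compl]; exact h.2.2⟩

theorem IsMinCut.two_mul_opp_le {G : SimpleGraph V} {S : Finset V} (h : IsMinCut G S)
    {w : V} (hlt : cut G S < deg G w) : 2 * opp G (side S) w ≤ deg G w := by
  have key : ∀ S : Finset V, IsMinCut G S → cut G S < deg G w → w ∈ S →
      2 * opp G (side S) w ≤ deg G w := by
    intro S h hlt hw
    have hS : S.erase w ∪ {w} = S := by
      rw [union_comm, ← insert_eq, insert_erase hw]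
    have hadd := cut_add_cut G (A := S.erase w) (B := {w}) (by simp)
    rw [hS, cut_singleton, edgeCount_comm, edgeCount_singleton_erase] at hadd
    have hdeg : deg G w = edgeCount G {w} S + edgeCount G {w} Sᶜ := by
      rw [deg_eq_edgeCount, ← union_compl S, edgeCount_union_right G _ disjoint_compl_right]
    have hne : S.erase w ≠ ∅ := by
      intro he
      rw [he, empty_union] at hS
      rw [← hS, cut_singleton] at hlt
      exact lt_irrefl _ hlt
    have hne' : S.erase w ≠ univ := fun he => absurd (he ▸ mem_univ w) (notMem_erase w S)
    have := h.2.2 _ hne hne'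
    rw [opp_side_of_mem G hw]
    omega
  by_cases hw : w ∈ S
  · exact key S h hlt hw
  · rw [← opp_side_compl]
    exact key Sᶜ h.compl (by rwa [cut_compl]) (mem_compl.mpr hw)

/-- The two-colouring `σ ∘ f` could be within `x` changes of a cut of size at most `δ`, as far as
the edge counts to fibres of `f` can tell. -/
def IsPlausible (G : SimpleGraph V) (f : V → ι) (δ x : ℕ) (σ : ι → Bool) : Prop :=
  ∃ X : Finset V, #X ≤ x ∧ ∑ w ∈ Xᶜ, (opp G (σ ∘ f) w - x) ≤ 2 * δ

theorem isPlausible_of_near {G : SimpleGraph V} {f : V → ι} {δ x : ℕ} {σ : ι → Bool}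
    {S : Finset V} (hX : #{w | (σ ∘ f) w ≠ side S w} ≤ x) (hS : cut G S ≤ δ) :
    IsPlausible G f δ x σ := by
  refine ⟨_, hX, ?_⟩
  calc ∑ w ∈ ({w | (σ ∘ f) w ≠ side S w} : Finset V)ᶜ, (opp G (σ ∘ f) w - x)
      ≤ ∑ w ∈ ({w | (σ ∘ f) w ≠ side S w} : Finset V)ᶜ, opp G (side S) w := by
        refine sum_le_sum fun w hw => ?_
        have hw' : (σ ∘ f) w = side S w := by simpa using hw
        have := opp_le_opp_add G (σ ∘ f) (side S) hw'
        omega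
    _ ≤ ∑ w, opp G (side S) w := sum_le_sum_of_subset (subset_univ _)
    _ ≤ 2 * δ := by rw [sum_opp_side]; omega

open Classical in
/-- From the edge counts between vertices and fibres of `f` one can compute a partition of `V` into
few parts that is respected by all locally minimal small cuts which nearly respect `f`. -/
theorem exists_partition [Fintype ι] [DecidableEq ι] (H : SimpleGraph V) (f : V → ι) {δ x : ℕ}
    (hδ : ∀ w, δ ≤ deg H w) (hδ0 : 0 < δ) (hx : 8 * x ≤ δ) (hkx : 8 * (Fintype.card ι * x) ≤ δ) :
    ∃ p : V → Set ι ⊕ V, #(univ.image p) ≤ Fintype.card ι * (x + 9) ∧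
      ∀ G, FiberAgree f G H → ∀ S : Finset V, ∀ σ : ι → Bool,
        #{w | (σ ∘ f) w ≠ side S w} ≤ x → cut G S ≤ δ →
        (∀ w, 2 * opp G (side S) w ≤ deg G w) →
        ∀ u v, p u = p v → (u ∈ S ↔ v ∈ S) := by
  obtain ⟨B, hBF, hBc, hB⟩ := exists_separating_subfamily {σ | IsPlausible H f δ x σ}
  let r : ι → ι → Prop := fun i j => ∀ σ ∈ B, σ i = σ j
  let inner : SimpleGraph V → V → ℕ := fun G w =>
    ∑ u, (if r (f u) (f w) then 1 else 0) * adjInd G w u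
  let core : V → Prop := fun w => deg H w + 2 * x < 2 * inner H w
  refine ⟨fun w => if core w then .inl {i | r i (f w)} else .inr w, ?_, ?_⟩
  · choose! X hXc hXs using fun σ (hσ : σ ∈ B) => hBF hσ
    set k := Fintype.card ι
    have hZ : #(B.biUnion X) ≤ k * x :=
      (card_biUnion_le_card_mul _ _ _ hXc).trans (Nat.mul_le_mul_right x hBc)
    set Y : Finset V := univ.filter fun w => ¬ core w ∧ w ∉ B.biUnion X with hY
    have hYc : #Y ≤ 8 * k := by
      have hlow : ∀ w ∈ Y, δ ≤ 4 * ∑ σ ∈ B, if w ∈ X σ then 0 else opp H (σ ∘ f) w - x := by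
        intro w hw
        obtain ⟨-, hcore, hwZ⟩ := mem_filter.mp hw
        have hdeg : deg H w ≤ inner H w + ∑ σ ∈ B, opp H (σ ∘ f) w := by
          simp only [opp]
          rw [sum_comm, ← sum_add_distrib]
          refine sum_le_sum fun u _ => ?_
          by_cases hr : r (f u) (f w)
          · simp [hr]
          · obtain ⟨σ, hσ, hne⟩ : ∃ σ ∈ B, σ (f u) ≠ σ (f w) := by
              by_contra! hcon
              exact hr hcon
            refine le_add_left ((le_of_eq ?_).trans (single_le_sum
              (f := fun σ : ι → Bool => if (σ ∘ f) u = (σ ∘ f) w then 0 else adjInd H w u)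
              (fun _ _ => Nat.zero_le _) hσ))
            simp [hne]
        have hopp : ∑ σ ∈ B, opp H (σ ∘ f) w ≤
            k * x + ∑ σ ∈ B, if w ∈ X σ then 0 else opp H (σ ∘ f) w - x := by
          calc ∑ σ ∈ B, opp H (σ ∘ f) w
              ≤ ∑ σ ∈ B, (x + if w ∈ X σ then 0 else opp H (σ ∘ f) w - x) := by
                refine sum_le_sum fun σ hσ => ?_
                rw [if_neg fun h => hwZ (mem_biUnion.mpr ⟨σ, hσ, h⟩)]
                omega
            _ ≤ _ := by
                rw [sum_add_distrib, sum_const, smul_eq_mul]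
                exact Nat.add_le_add_right (Nat.mul_le_mul_right x hBc) _
        have := hδ w
        simp only [core, not_lt] at hcore
        omega
      have hup : ∑ w ∈ Y, 4 * ∑ σ ∈ B, (if w ∈ X σ then 0 else opp H (σ ∘ f) w - x) ≤
          8 * k * δ := by
        rw [← mul_sum, sum_comm]
        calc 4 * ∑ σ ∈ B, ∑ w ∈ Y, (if w ∈ X σ then 0 else opp H (σ ∘ f) w - x)
            ≤ 4 * ∑ σ ∈ B, 2 * δ := by
              refine Nat.mul_le_mul_left 4 (sum_le_sum fun σ hσ => le_trans ?_ (hXs σ hσ))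
              refine (sum_le_sum_of_subset (subset_univ Y)).trans (le_of_eq ?_)
              rw [← sum_add_sum_compl (X σ), sum_eq_zero fun w hw => if_pos hw, zero_add]
              exact sum_congr rfl fun w hw => if_neg (mem_compl.mp hw)
          _ ≤ 8 * k * δ := by
              rw [sum_const, smul_eq_mul]
              calc 4 * (#B * (2 * δ)) ≤ 4 * (k * (2 * δ)) := by gcongr
                _ = 8 * k * δ := by ring
      have := (card_nsmul_le_sum Y _ δ hlow).trans hup
      rw [smul_eq_mul] at this
      exact Nat.le_of_mul_le_mul_right this hδ0
    have hsub : univ.image (fun w => if core w then (.inl {i | r i (f w)} : Set ι ⊕ V) else .inr w)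
        ⊆ univ.image (fun i => .inl {j | r j i}) ∪ (B.biUnion X ∪ Y).image .inr := by
      intro q hq
      obtain ⟨w, -, rfl⟩ := mem_image.mp hq
      by_cases hw : core w
      · rw [if_pos hw]
        exact mem_union_left _ (mem_image_of_mem _ (mem_univ (f w)))
      · rw [if_neg hw]
        refine mem_union_right _ (mem_image_of_mem _ ?_)
        by_cases hwZ : w ∈ B.biUnion X
        · exact mem_union_left _ hwZ
        · exact mem_union_right _ (mem_filter.mpr ⟨mem_univ w, hw, hwZ⟩)
    have h1 := (card_le_card hsub).trans (card_union_le _ _)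
    have h2 : #(univ.image fun i => (.inl {j | r j i} : Set ι ⊕ V)) ≤ k := card_image_le
    have h3 : #((B.biUnion X ∪ Y).image (.inr : V → Set ι ⊕ V)) ≤ #(B.biUnion X) + #Y :=
      card_image_le.trans (card_union_le _ _)
    rw [Nat.mul_add]
    omega
  · intro G hGH S σ hσ hS hloc u v huv
    have hplaus : IsPlausible H f δ x σ := by
      obtain ⟨X, hX, hsum⟩ := isPlausible_of_near hσ hS
      exact ⟨X, hX, by simpa only [hGH.opp_eq] using hsum⟩
    have hcore : ∀ w, core w → (σ ∘ f) w = side S w := by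
      intro w hw
      by_contra hne
      have hle : inner G w ≤ opp G (side S) w + #{w | (σ ∘ f) w ≠ side S w} := by
        rw [opp, card_filter, ← sum_add_distrib]
        refine sum_le_sum fun u _ => ?_
        have hadj := adjInd_le_one G w u
        by_cases hr : r (f u) (f w)
        · have hσr : σ (f u) = σ (f w) := hB _ _ hr σ hplaus
          simp only [hr, if_true, one_mul]
          by_cases hu : (σ ∘ f) u = side S u
          · rw [if_neg]
            · exact Nat.le_add_right _ _
            · rw [← hu]
              exact fun h => hne (hσr.symm.trans h)
          · rw [if_pos hu]
            omega
        · simp [hr]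
      have h1 : inner G w = inner H w := hGH.sum_eq (fun i => if r i (f w) then 1 else 0) w
      have h2 := hGH.deg_eq w
      have h3 := hloc w
      simp only [core] at hw
      omega
    by_cases hu : core u <;> by_cases hv : core v <;> simp only [hu, hv, if_true, if_false] at huv
    · have hset := Sum.inl_injective huv
      have hr : r (f u) (f v) := by
        have : f u ∈ {i | r i (f u)} := fun _ _ => rfl
        rwa [hset] at this
      rw [← side_eq_side, ← hcore u hu, ← hcore v hv]
      exact hB _ _ hr σ hplaus
    · exact absurd huv (by simp)
    · exact absurd huv (by simp)
    · rw [Sum.inr_injective huv]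

end Contraction

section Quotient

variable {V α : Type}

theorem edgeCount_fiberwise [DecidableEq α] (G : SimpleGraph V) (p : V → α) (A B : Finset V) :
    edgeCount G A B = ∑ a ∈ A.image p, ∑ b ∈ B.image p,
      edgeCount G (A.filter (p · = a)) (B.filter (p · = b)) := by
  unfold edgeCount
  refine (sum_fiberwise_of_maps_to (fun v hv => mem_image_of_mem p hv) _).symm.trans ?_
  refine sum_congr rfl fun a _ => ?_
  refine Eq.trans (sum_congr rfl fun v _ => ?_) sum_comm
  exact (sum_fiberwise_of_maps_to (fun v hv => mem_image_of_mem p hv) _).symm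

variable [Fintype V] [DecidableEq V]

theorem cut_eq_of_fiberwise [DecidableEq α] {G K : SimpleGraph V} {p : V → α}
    (h : ∀ u v, p u ≠ p v → edgeCount K (univ.filter (p · = p u)) (univ.filter (p · = p v)) =
      edgeCount G (univ.filter (p · = p u)) (univ.filter (p · = p v)))
    {S : Finset V} (hS : ∀ u v, p u = p v → (u ∈ S ↔ v ∈ S)) : cut K S = cut G S := by
  have hfib : ∀ T : Finset V, (∀ u v, p u = p v → (u ∈ T ↔ v ∈ T)) → ∀ v ∈ T,
      T.filter (p · = p v) = univ.filter (p · = p v) := by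
    intro T hT v hv
    ext u
    simp only [mem_filter, mem_univ, true_and, and_iff_right_iff_imp]
    exact fun huv => (hT u v huv).mpr hv
  have hSc : ∀ u v, p u = p v → (u ∈ Sᶜ ↔ v ∈ Sᶜ) := by
    intro u v huv
    simp only [mem_compl, hS u v huv]
  rw [cut, cut, edgeCount_fiberwise K p, edgeCount_fiberwise G p]
  refine sum_congr rfl fun a ha => sum_congr rfl fun b hb => ?_
  obtain ⟨u, hu, rfl⟩ := mem_image.mp ha
  obtain ⟨v, hv, rfl⟩ := mem_image.mp hb
  rw [hfib S hS u hu, hfib Sᶜ hSc v hv]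
  exact h u v fun huv => mem_compl.mp hv ((hS u v huv).mp hu)

/-- Find a minimum cut among the cuts respecting a given partition of the vertices. -/
theorem solves_min_of_partition [DecidableEq α] (p : V → α) :
    Solves (3 * #(univ.image p) ^ 2) (fun G (S : Finset V) =>
      ∀ T : Finset V, T ≠ ∅ → T ≠ univ → (∀ u v, p u = p v → (u ∈ T ↔ v ∈ T)) →
        S ≠ ∅ ∧ S ≠ univ ∧ cut G S ≤ cut G T) := by
  classical
  let fib : α → Finset V := fun a => univ.filter (p · = a)
  let Ps : Finset (Finset V × Finset V) :=
    (univ.image p ×ˢ univ.image p).image fun q => (fib q.1, fib q.2)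
  have hPs : #Ps ≤ #(univ.image p) ^ 2 := by
    rw [sq, ← card_product]
    exact card_image_le
  refine Solves.mono ((solves_agree_edgeCount Ps).bind (e := 0) fun K => ?_)
    (Nat.mul_le_mul_left 3 hPs)
  have key : ∀ G : SimpleGraph V,
      (∀ P ∈ Ps, Disjoint P.1 P.2 → edgeCount K P.1 P.2 = edgeCount G P.1 P.2) →
      ∀ S : Finset V, (∀ u v, p u = p v → (u ∈ S ↔ v ∈ S)) → cut K S = cut G S := by
    intro G hG S hS
    refine cut_eq_of_fiberwise (fun u v huv => hG (fib (p u), fib (p v)) ?_ ?_) hS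
    · exact mem_image.mpr ⟨(p u, p v), by simp, rfl⟩
    · rw [disjoint_filter]
      exact fun w _ h1 h2 => huv (h1.symm.trans h2)
  by_cases hne : ({T | T ≠ ∅ ∧ T ≠ univ ∧ ∀ u v, p u = p v → (u ∈ T ↔ v ∈ T)} :
      Finset (Finset V)).Nonempty
  · obtain ⟨S, hS, hmin⟩ := exists_min_image _ (cut K) hne
    simp only [mem_filter, mem_univ, true_and] at hS hmin
    refine .pure S (fun G hG T h1 h2 h3 => ⟨hS.1, hS.2.1, ?_⟩) 0
    rw [← key G hG S hS.2.2, ← key G hG T h3]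
    exact hmin T ⟨h1, h2, h3⟩
  · refine .pure ∅ (fun G _ T h1 h2 h3 => absurd ⟨T, ?_⟩ hne) 0
    simpa only [mem_filter, mem_univ, true_and] using ⟨h1, h2, h3⟩

end Quotient

section LargeDegree

variable {V ι : Type} [Fintype V] [DecidableEq V]

/-- Find a cut at least as good as every small minimum cut which nearly respects the fibres
of `f`. -/
theorem solves_near_fibers [Fintype ι] [DecidableEq ι] (f : V → ι) {δ x : ℕ} (hδ0 : 0 < δ)
    (hx : 8 * x ≤ δ) (hkx : 8 * (Fintype.card ι * x) ≤ δ) :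
    Solves (3 * (Fintype.card V * Fintype.card ι) + 3 * (Fintype.card ι * (x + 9)) ^ 2)
      (fun G (S : Finset V) => (∀ w, δ ≤ deg G w) → ∀ T, IsMinCut G T → cut G T < δ →
        ∀ σ : ι → Bool, #{w | (σ ∘ f) w ≠ side T w} ≤ x →
          S ≠ ∅ ∧ S ≠ univ ∧ cut G S ≤ cut G T) := by
  classical
  let Ps : Finset (Finset V × Finset V) :=
    (univ : Finset (V × ι)).image fun q => ({q.1}, (univ.filter (f · = q.2)).erase q.1)
  have hPs : #Ps ≤ Fintype.card V * Fintype.card ι := by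
    rw [← Fintype.card_prod]
    exact card_image_le
  refine ((solves_agree_edgeCount Ps).mono (Nat.mul_le_mul_left 3 hPs)).bind fun H => ?_
  have hagree : ∀ G : SimpleGraph V,
      (∀ P ∈ Ps, Disjoint P.1 P.2 → edgeCount H P.1 P.2 = edgeCount G P.1 P.2) →
      FiberAgree f G H := by
    intro G hG w i
    have := hG ({w}, (univ.filter (f · = i)).erase w)
      (mem_image.mpr ⟨(w, i), mem_univ _, rfl⟩) (by simp)
    rw [edgeCount_singleton_erase, edgeCount_singleton_erase] at this
    exact this.symm
  by_cases hH : ∀ w, δ ≤ deg H w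
  · obtain ⟨p, hp, hinv⟩ := exists_partition H f hH hδ0 hx hkx
    refine ((solves_min_of_partition p).weaken
      fun G S hS hG hδ T hT hlt σ hσ => ?_).mono ?_
    · exact hS T hT.1 hT.2.1 (hinv G (hagree G hG) T σ hσ hlt.le
        fun w => hT.two_mul_opp_le (hlt.trans_le (hδ w)))
    · gcongr
  · refine .pure ∅ (fun G hG hδ => absurd (fun w => ?_) hH) _
    rw [← (hagree G hG).deg_eq]
    exact hδ w

theorem solves_near_map (f : V → V) {δ k x : ℕ} (hδ0 : 0 < δ) (hx : 8 * x ≤ δ)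
    (hkx : 8 * (k * x) ≤ δ) :
    Solves (3 * (Fintype.card V * k) + 3 * (k * (x + 9)) ^ 2)
      (fun G (S : Finset V) => #(univ.image f) ≤ k → (∀ w, δ ≤ deg G w) →
        ∀ T, IsMinCut G T → cut G T < δ → #{w | side T (f w) ≠ side T w} ≤ x →
          S ≠ ∅ ∧ S ≠ univ ∧ cut G S ≤ cut G T) := by
  by_cases hk : #(univ.image f) ≤ k
  · have hcard : Fintype.card (univ.image f) ≤ k := by rwa [Fintype.card_coe]
    refine ((solves_near_fibers (ι := univ.image f)
      (fun w => ⟨f w, mem_image_of_mem f (mem_univ w)⟩) hδ0 hx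
      (le_trans (by gcongr) hkx)).weaken fun G S hS _ hδ T hT hlt hmis => ?_).mono ?_
    · exact hS hδ T hT hlt (fun i => side T i) hmis
    · gcongr
  · exact .pure ∅ (fun G h => absurd h hk) _

theorem sum_card_side_ne_le (G : SimpleGraph V) {F : ℕ → V → V} {t : ℕ}
    (hadj : ∀ j < t, ∀ w, G.Adj w (F j w)) (hF : ∀ j < t, ∀ i < j, ∀ w, F i w ≠ F j w)
    (S : Finset V) : ∑ j ∈ range t, #{w | side S (F j w) ≠ side S w} ≤ 2 * cut G S := by
  rw [← sum_opp_side]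
  simp only [card_filter]
  rw [sum_comm]
  refine sum_le_sum fun w _ => ?_
  have hinj : Set.InjOn (fun j => F j w) (range t) := by
    intro i hi j hj hij
    rw [coe_range, Set.mem_Iio] at hi hj
    rcases lt_trichotomy i j with h | h | h
    · exact absurd hij (hF j hj i h w)
    · exact h
    · exact absurd hij.symm (hF i hi j h w)
  calc ∑ j ∈ range t, (if side S (F j w) ≠ side S w then 1 else 0)
      = ∑ j ∈ range t, (if side S (F j w) = side S w then 0 else adjInd G w (F j w)) := by
        refine sum_congr rfl fun j hj => ?_
        rw [adjInd_eq_one.mpr (hadj j (mem_range.mp hj) w), ite_not]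
    _ = ∑ u ∈ (range t).image (fun j => F j w),
          (if side S u = side S w then 0 else adjInd G w u) := (sum_image
          (f := fun u => if side S u = side S w then 0 else adjInd G w u) hinj).symm
    _ ≤ opp G (side S) w := sum_le_sum_of_subset (subset_univ _)

theorem solves_isMinCut_of_large_degree (hV : 2 ≤ Fintype.card V) (v₀ : V) {δ k t x : ℕ}
    (hk : Fintype.card V * (2 * Fintype.card V - δ) ^ k < (2 * Fintype.card V) ^ k)
    (htk : 2 * (t * k) ≤ δ) (hδ0 : 0 < δ) (hx : 8 * x ≤ δ) (hkx : 8 * (k * x) ≤ δ)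
    (hxt : 2 * δ ≤ t * (x + 1)) :
    Solves (t * (k * (6 * Fintype.card V)) +
        (t * (3 * (Fintype.card V * k) + 3 * (k * (x + 9)) ^ 2) + (t + 1)))
      (fun G (S : Finset V) => (∀ w, δ ≤ deg G w) → cut G {v₀} ≤ δ → IsMinCut G S) := by
  have : Nonempty V := ⟨v₀⟩
  refine (solves_star_forests δ k t hk).bind fun F => ?_
  refine (solves_forall_lt t fun j _ => solves_near_map (F j) hδ0 hx hkx).bind fun R => ?_
  let Qs : Finset (Finset V) := insert {v₀} ((range t).image R)
  have hQs : #Qs ≤ t + 1 :=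
    (card_insert_le _ _).trans (Nat.succ_le_succ (card_image_le.trans_eq (card_range t)))
  refine Solves.mono ((solves_agree Qs).bind (e := 0) fun K => ?_) hQs
  obtain ⟨S, hS, hmin⟩ := exists_min_image (Qs.filter fun Q => Q ≠ ∅ ∧ Q ≠ univ) (cut K)
    ⟨{v₀}, by simp [Qs, singleton_ne_univ hV]⟩
  obtain ⟨hSQ, hS1, hS2⟩ := mem_filter.mp hS
  refine .pure S (fun G hK hR hF hδ hv₀ => ?_) 0
  have hle : ∀ Q ∈ Qs, Q ≠ ∅ → Q ≠ univ → cut G S ≤ cut G Q := by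
    intro Q hQ h1 h2
    rw [← hK S hSQ, ← hK Q hQ]
    exact hmin Q (mem_filter.mpr ⟨hQ, h1, h2⟩)
  obtain ⟨T, hT⟩ := exists_isMinCut hV G
  suffices h : cut G S ≤ cut G T from ⟨hS1, hS2, fun U h1 h2 => h.trans (hT.2.2 U h1 h2)⟩
  rcases Nat.lt_or_ge (cut G T) δ with hlt | hge
  · obtain ⟨hadj, hcard, hdis⟩ := hF hδ htk
    obtain ⟨j, hj, hmis⟩ : ∃ j < t, #{w | side T (F j w) ≠ side T w} ≤ x := by
      by_contra! hcon
      have h1 := sum_card_side_ne_le G hadj hdis T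
      have h2 := card_nsmul_le_sum (range t) (fun j => #{w | side T (F j w) ≠ side T w}) (x + 1)
        fun j hj => hcon j (mem_range.mp hj)
      rw [card_range, smul_eq_mul] at h2
      omega
    obtain ⟨h1, h2, h3⟩ := hR j hj (hcard j hj) hδ T hT hlt hmis
    exact (hle _ (mem_insert_of_mem (mem_image_of_mem R (mem_range.mpr hj))) h1 h2).trans h3
  · exact (hle _ (mem_insert_self _ _) (singleton_ne_empty v₀) (singleton_ne_univ hV v₀)).trans
      (hv₀.trans hge)

end LargeDegree

section Parameters

theorem two_mul_pow_le {a δ s : ℕ} (ha : 0 < a) (hs : a ≤ s * δ) : 2 * a ^ s ≤ (a + δ) ^ s := by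
  have h : ∀ s, a ^ s * (a + s * δ) ≤ (a + δ) ^ s * a := by
    intro s
    induction s with
    | zero => simp
    | succ s ih =>
      calc a ^ (s + 1) * (a + (s + 1) * δ)
          = a * (a ^ s * (a + s * δ)) + a ^ s * (a * δ) := by ring
        _ ≤ a * ((a + δ) ^ s * a) + (a + δ) ^ s * (a * δ) := by gcongr; omega
        _ = (a + δ) ^ (s + 1) * a := by ring
  refine Nat.le_of_mul_le_mul_right ?_ ha
  calc 2 * a ^ s * a = a ^ s * (a + a) := by ring
    _ ≤ a ^ s * (a + s * δ) := by gcongr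
    _ ≤ (a + δ) ^ s * a := h s

theorem mul_pow_lt_pow {n δ s L : ℕ} (hδ : δ < 2 * n) (hs : 2 * n ≤ s * δ) (hL : n < 2 ^ L) :
    n * (2 * n - δ) ^ (s * L) < (2 * n) ^ (s * L) := by
  obtain ⟨a, ha⟩ : ∃ a, 2 * n = a + δ := ⟨2 * n - δ, by omega⟩
  have ha0 : 0 < a := by omega
  rw [ha, Nat.add_sub_cancel, pow_mul, pow_mul]
  calc n * (a ^ s) ^ L < 2 ^ L * (a ^ s) ^ L := by gcongr
    _ = (2 * a ^ s) ^ L := (mul_pow _ _ _).symm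
    _ ≤ ((a + δ) ^ s) ^ L := by
      gcongr
      exact two_mul_pow_le ha0 (by omega)

variable {V : Type} [Fintype V] [DecidableEq V]

theorem solves_isMinCut_of_dense (hV : 2 ≤ Fintype.card V) {m L : ℕ}
    (hm : Fintype.card V ≤ m ^ 3) (hL : Fintype.card V < 2 ^ L) (v₀ : V) {δ : ℕ}
    (hδn : δ < Fintype.card V) (hδ : 48 * m ^ 2 * L ≤ δ) :
    Solves (686 * m ^ 5 * L ^ 2)
      (fun G (S : Finset V) => (∀ w, δ ≤ deg G w) → cut G {v₀} ≤ δ → IsMinCut G S) := by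
  set n := Fintype.card V with hn
  have hm0 : 0 < m := by
    rcases Nat.eq_zero_or_pos m with rfl | h
    · simp at hm; omega
    · exact h
  have hL0 : 0 < L := by
    rcases Nat.eq_zero_or_pos L with rfl | h
    · simp at hL; omega
    · exact h
  have hδ0 : 0 < δ := lt_of_lt_of_le (by positivity) hδ
  obtain ⟨s, hs1, hs2⟩ : ∃ s, 2 * n ≤ s * δ ∧ s * δ ≤ 3 * n := by
    refine ⟨2 * n / δ + 1, ?_, ?_⟩
    · exact (Nat.lt_div_mul_add hδ0).le.trans_eq (by ring)
    · have := Nat.div_mul_le_self (2 * n) δ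
      rw [Nat.add_mul]
      omega
  have hs0 : 0 < s := by
    rcases Nat.eq_zero_or_pos s with rfl | h
    · simp at hs1; omega
    · exact h
  set k := s * L with hk
  have hk0 : 0 < k := Nat.mul_pos hs0 hL0
  have hkδ : k * δ ≤ 3 * m ^ 3 * L := by
    calc k * δ = s * δ * L := by rw [hk]; ring
      _ ≤ 3 * n * L := by gcongr
      _ ≤ 3 * m ^ 3 * L := by gcongr
  have hkm : 16 * k ≤ m := by
    refine Nat.le_of_mul_le_mul_right ?_ hδ0
    calc 16 * k * δ = 16 * (k * δ) := by ring
      _ ≤ 16 * (3 * m ^ 3 * L) := by gcongr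
      _ = m * (48 * m ^ 2 * L) := by ring
      _ ≤ m * δ := by gcongr
  have hmk : 2 * (m * k) ≤ δ := by
    refine Nat.le_of_mul_le_mul_right ?_ hδ0
    calc 2 * (m * k) * δ = 2 * m * (k * δ) := by ring
      _ ≤ 2 * m * (3 * m ^ 3 * L) := by gcongr
      _ = 6 * m ^ 4 * (L * 1) := by ring
      _ ≤ 2304 * m ^ 4 * (L * L) := by gcongr <;> omega
      _ = (48 * m ^ 2 * L) * (48 * m ^ 2 * L) := by ring
      _ ≤ δ * δ := by gcongr
  set x := 2 * δ / m with hx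
  have hxm : x * m ≤ 2 * δ := Nat.div_mul_le_self _ _
  have hkx : 8 * (k * x) ≤ δ := by
    refine Nat.le_of_mul_le_mul_right ?_ hm0
    calc 8 * (k * x) * m = 8 * k * (x * m) := by ring
      _ ≤ 8 * k * (2 * δ) := by gcongr
      _ = 16 * k * δ := by ring
      _ ≤ m * δ := by gcongr
      _ = δ * m := Nat.mul_comm _ _
  have hx8 : 8 * x ≤ δ := (Nat.mul_le_mul_left 8 (Nat.le_mul_of_pos_left x hk0)).trans hkx
  have hxt : 2 * δ ≤ m * (x + 1) := (Nat.lt_mul_div_succ (2 * δ) hm0).le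
  refine (solves_isMinCut_of_large_degree hV v₀ (mul_pow_lt_pow (by omega) hs1 hL) hmk hδ0 hx8 hkx
    hxt).mono ?_
  have hkxm : k * x ≤ 6 * m ^ 2 * L := by
    refine Nat.le_of_mul_le_mul_right ?_ hm0
    calc k * x * m = k * (x * m) := by ring
      _ ≤ k * (2 * δ) := by gcongr
      _ = 2 * (k * δ) := by ring
      _ ≤ 2 * (3 * m ^ 3 * L) := by gcongr
      _ = 6 * m ^ 2 * L * m := by ring
  have hkm' : k ≤ m := by omega
  have hM : k * (x + 9) ≤ 15 * m ^ 2 * L := by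
    calc k * (x + 9) = k * x + 9 * k := by ring
      _ ≤ 6 * m ^ 2 * L + 9 * (m * 1 * 1) := by gcongr; omega
      _ ≤ 6 * m ^ 2 * L + 9 * (m * m * L) := by gcongr <;> omega
      _ = 15 * m ^ 2 * L := by ring
  calc m * (k * (6 * n)) + (m * (3 * (n * k) + 3 * (k * (x + 9)) ^ 2) + (m + 1))
      ≤ m * (m * (6 * m ^ 3)) + (m * (3 * (m ^ 3 * m) + 3 * (15 * m ^ 2 * L) ^ 2) +
        (m + m)) := by gcongr; omega
    _ = 9 * m ^ 5 * 1 ^ 2 + 675 * m ^ 5 * L ^ 2 + 2 * m ^ 1 * 1 ^ 2 := by ring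
    _ ≤ 9 * m ^ 5 * L ^ 2 + 675 * m ^ 5 * L ^ 2 + 2 * m ^ 5 * L ^ 2 := by
        gcongr <;> omega
    _ = 686 * m ^ 5 * L ^ 2 := by ring

theorem solves_isMinCut (hV : 2 ≤ Fintype.card V) {m p : ℕ} (hm : Fintype.card V ≤ m ^ 3)
    (hp : Fintype.card V ≤ 2 ^ p) :
    Solves (687 * m ^ 5 * (p + 1) ^ 2) (fun G (S : Finset V) => IsMinCut G S) := by
  have : Nonempty V := Fintype.card_pos_iff.mp (by omega)
  have hm0 : 0 < m := by
    rcases Nat.eq_zero_or_pos m with rfl | h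
    · simp at hm
    · exact h
  have hL : Fintype.card V < 2 ^ (p + 1) := by
    rw [pow_succ]
    omega
  have hcard : #((univ : Finset V).image fun v => ({v} : Finset V)) ≤
      m ^ 5 * (p + 1) ^ 2 := by
    calc #((univ : Finset V).image fun v => ({v} : Finset V)) ≤ Fintype.card V := card_image_le
      _ ≤ m ^ 3 * 1 ^ 2 := by simpa using hm
      _ ≤ m ^ 5 * (p + 1) ^ 2 := by gcongr <;> omega
  refine Solves.mono ((solves_agree _).bind (e := 686 * m ^ 5 * (p + 1) ^ 2) fun K => ?_)
    ((Nat.add_le_add_right hcard _).trans_eq (by ring))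
  obtain ⟨v₀, -, hv₀⟩ := exists_min_image univ (deg K) univ_nonempty
  have hdeg : ∀ G : SimpleGraph V, (∀ Q ∈ (univ : Finset V).image fun v => ({v} : Finset V),
      cut K Q = cut G Q) → ∀ v, deg K v = deg G v := by
    intro G hG v
    rw [← cut_singleton, ← cut_singleton]
    exact hG {v} (mem_image_of_mem _ (mem_univ v))
  have hlt : deg K v₀ < Fintype.card V := by
    have h := edgeCount_le_mul K {v₀} (univ.erase v₀)
    rw [edgeCount_singleton_erase, ← deg_eq_edgeCount, card_singleton, one_mul,
      card_erase_of_mem (mem_univ v₀), card_univ] at h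
    omega
  rcases Nat.lt_or_ge (deg K v₀) (48 * m ^ 2 * (p + 1)) with hsmall | hlarge
  · refine Solves.mono (d := (deg K v₀ * Fintype.card V + 1) * (6 * p + 1)) ?_ ?_
    · refine (solves_isMinCut_of_small_degree hV hp v₀ (deg K v₀)).weaken fun G S hS hG => hS ?_
      rw [cut_singleton, hdeg G hG]
    · calc (deg K v₀ * Fintype.card V + 1) * (6 * p + 1)
          ≤ (deg K v₀ * Fintype.card V + Fintype.card V) * (6 * (p + 1)) := by
            gcongr <;> omega
        _ = (deg K v₀ + 1) * Fintype.card V * (6 * (p + 1)) := by ring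
        _ ≤ 48 * m ^ 2 * (p + 1) * m ^ 3 * (6 * (p + 1)) := by gcongr; omega
        _ = 288 * m ^ 5 * (p + 1) ^ 2 := by ring
        _ ≤ 686 * m ^ 5 * (p + 1) ^ 2 := by gcongr; omega
  · refine (solves_isMinCut_of_dense hV hm hL v₀ hlt hlarge).weaken fun G S hS hG => hS ?_ ?_
    · intro w
      rw [← hdeg G hG]
      exact hv₀ w (mem_univ w)
    · rw [cut_singleton, hdeg G hG]

end Parameters

theorem ceil_rpow_third_pow_five_le {n : ℕ} (hn : 1 ≤ n) :
    ((⌈(n : ℝ) ^ ((1 : ℝ) / 3)⌉₊ : ℕ) : ℝ) ^ 5 ≤ 32 * (n : ℝ) ^ ((5 : ℝ) / 3) := by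
  have h0 : (0 : ℝ) ≤ n := n.cast_nonneg
  have h1 : (1 : ℝ) ≤ (n : ℝ) ^ ((1 : ℝ) / 3) :=
    Real.one_le_rpow (by exact_mod_cast hn) (by norm_num)
  have h2 := Nat.ceil_lt_add_one (zero_le_one.trans h1)
  calc ((⌈(n : ℝ) ^ ((1 : ℝ) / 3)⌉₊ : ℕ) : ℝ) ^ 5
      ≤ (2 * (n : ℝ) ^ ((1 : ℝ) / 3)) ^ 5 := by gcongr; linarith
    _ = 32 * ((n : ℝ) ^ ((1 : ℝ) / 3)) ^ 5 := by rw [mul_pow]; norm_num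
    _ = 32 * (n : ℝ) ^ ((5 : ℝ) / 3) := by
      rw [← Real.rpow_natCast, ← Real.rpow_mul h0]
      norm_num

theorem le_ceil_rpow_third_pow_three (n : ℕ) : n ≤ ⌈(n : ℝ) ^ ((1 : ℝ) / 3)⌉₊ ^ 3 := by
  have h0 : (0 : ℝ) ≤ n := n.cast_nonneg
  have h : (n : ℝ) ≤ ((⌈(n : ℝ) ^ ((1 : ℝ) / 3)⌉₊ : ℕ) : ℝ) ^ 3 := by
    calc (n : ℝ) = ((n : ℝ) ^ ((1 : ℝ) / 3)) ^ 3 := by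
          rw [← Real.rpow_natCast, ← Real.rpow_mul h0]
          norm_num
      _ ≤ _ := by
          gcongr
          exact Nat.le_ceil _
  exact_mod_cast h

theorem clog_add_one_le {n : ℕ} (hn : 2 ≤ n) : (Nat.clog 2 n + 1 : ℝ) ≤ 5 * Real.log n := by
  have hc : 0 < Nat.clog 2 n := Nat.clog_pos one_lt_two hn
  have hlt : 2 ^ (Nat.clog 2 n - 1) < n := Nat.pow_pred_clog_lt_self one_lt_two hn
  have h1 : ((Nat.clog 2 n - 1 : ℕ) : ℝ) * Real.log 2 ≤ Real.log n := by
    rw [← Real.log_pow]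
    exact Real.log_le_log (by positivity) (by exact_mod_cast hlt.le)
  have h2 : Real.log 2 ≤ Real.log n := Real.log_le_log two_pos (by exact_mod_cast hn)
  have h3 := Real.log_two_gt_d9
  rw [Nat.cast_sub hc, Nat.cast_one] at h1
  have h4 : (1 : ℝ) ≤ Nat.clog 2 n := by exact_mod_cast hc
  nlinarith

end CutQuery

/-- There exist constants `C > 0` and `c ≥ 0` such that for every
`n ≥ 2` and every finite vertex set `V` with `|V| = n`, there is a deterministic
cut-query decision tree over `V` of depth at most `C·n^{5/3}·(log n)^c` which,
for every simple graph `G` on `V`, outputs a global minimum cut of `G`. -/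
theorem deterministic_global_mincut_cut_queries :
    ∃ (C : ℝ) (c : ℕ), 0 < C ∧
      ∀ (n : ℕ), 2 ≤ n →
        ∀ (V : Type) [Fintype V] [DecidableEq V], Fintype.card V = n →
          ∃ (T : CutQueryTree V (Finset V)) (d : ℕ),
            CutQueryTree.DepthLE T d ∧
            (d : ℝ) ≤ C * (n : ℝ) ^ ((5 : ℝ) / 3) * (Real.log n) ^ c ∧
            ∀ (G : SimpleGraph V) [DecidableRel G.Adj],
              (T.run (fun Q => cutCard G Q)) ≠ ∅ ∧
              (T.run (fun Q => cutCard G Q)) ≠ Finset.univ ∧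
              ∀ S : Finset V, S ≠ ∅ → S ≠ Finset.univ →
                cutCard G (T.run (fun Q => cutCard G Q)) ≤ cutCard G S := by
  classical
  refine ⟨687 * 32 * 5 ^ 2, 2, by norm_num, fun n hn V _ _ hV => ?_⟩
  subst hV
  set n := Fintype.card V
  obtain ⟨T, hT, hmin⟩ := CutQuery.solves_isMinCut hn
    (CutQuery.le_ceil_rpow_third_pow_three n) (Nat.le_pow_clog one_lt_two n)
  refine ⟨T, _, hT, ?_, fun G _ => ?_⟩
  · push_cast
    calc 687 * (⌈(n : ℝ) ^ ((1 : ℝ) / 3)⌉₊ : ℝ) ^ 5 * (Nat.clog 2 n + 1 : ℝ) ^ 2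
        ≤ 687 * (32 * (n : ℝ) ^ ((5 : ℝ) / 3)) * (5 * Real.log n) ^ 2 := by
          gcongr
          · exact CutQuery.ceil_rpow_third_pow_five_le (one_le_two.trans hn)
          · exact CutQuery.clog_add_one_le hn
      _ = 687 * 32 * 5 ^ 2 * (n : ℝ) ^ ((5 : ℝ) / 3) * Real.log n ^ 2 := by ring
  · simp only [CutQuery.cutCard_eq_cut]
    exact hmin G
end

section
/- Let G be a finite simple graph on vertex set V in which every vertex has degree at least δ, and let R ⊆ V be a dominating set of G. Then for every set C with ∅ ≠ C ≠ V and |∂_G C| < δ, both R ∩ C and R \ C are nonempty. In other words, every dominating set is (δ−1)-separated. -/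
theorem cutCard_compl {V : Type*} [Fintype V] [DecidableEq V] (G : SimpleGraph V)
    [DecidableRel G.Adj] (S : Finset V) : cutCard G Sᶜ = cutCard G S := by
  refine Finset.card_bij' (fun p _ => p.swap) (fun p _ => p.swap) ?_ ?_ ?_ ?_ <;>
    simp +contextual [G.adj_comm]

/-- If every vertex of `S` has a neighbor outside `S`, then the cut of `S` has at least as many
edges as the degree of any vertex of `S`. -/
theorem degree_le_cutCard {V : Type*} [Fintype V] [DecidableEq V] (G : SimpleGraph V)
    [DecidableRel G.Adj] {S : Finset V} (hS : ∀ v ∈ S, ∃ u ∉ S, G.Adj v u) {v : V}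
    (hv : v ∈ S) : G.degree v ≤ cutCard G S := by
  choose! f hf hadj using hS
  rw [← G.card_neighborFinset_eq_degree, cutCard]
  refine Finset.card_le_card_of_injOn (fun u => if u ∈ S then (u, f u) else (v, u)) ?_ ?_
  · intro u hu
    have hvu : G.Adj v u := by simpa using hu
    by_cases h : u ∈ S <;> simp [h, hv, hvu, hf, hadj]
  · intro u hu w hw h
    have hvu : v ≠ u := G.ne_of_adj (by simpa using hu)
    have hvw : v ≠ w := G.ne_of_adj (by simpa using hw)
    grind

/-- A dominating set meets every nonempty vertex set whose cut is smaller than the minimum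
degree. -/
theorem inter_nonempty_of_cutCard_lt {V : Type*} [Fintype V] [DecidableEq V]
    (G : SimpleGraph V) [DecidableRel G.Adj] {δ : ℕ} (hdeg : ∀ v : V, δ ≤ G.degree v)
    {R : Finset V} (hdom : ∀ v : V, v ∈ R ∨ ∃ u ∈ R, G.Adj v u)
    {S : Finset V} (hS : S.Nonempty) (hcut : cutCard G S < δ) : (R ∩ S).Nonempty := by
  by_contra hempty
  rw [Finset.not_nonempty_iff_eq_empty, ← Finset.disjoint_iff_inter_eq_empty,
    Finset.disjoint_left] at hempty
  obtain ⟨v, hv⟩ := hS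
  refine (hcut.trans_le (hdeg v)).not_ge (degree_le_cutCard G (fun w hw => ?_) hv)
  obtain ⟨u, hu, hwu⟩ := (hdom w).resolve_left fun hR => hempty hR hw
  exact ⟨u, hempty hu, hwu⟩

/-- In a finite simple graph of minimum degree at least `δ`, any
dominating set `R` is `(δ−1)`-separated: every cut `(C, V \ C)` with
`∅ ≠ C ≠ V` and `|∂_G C| < δ` has both `R ∩ C` and `R \ C` nonempty. -/
theorem dominating_set_separated {V : Type*} [Fintype V] [DecidableEq V]
    (G : SimpleGraph V) [DecidableRel G.Adj] (δ : ℕ)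
    (hdeg : ∀ v : V, δ ≤ G.degree v)
    (R : Finset V) (hdom : ∀ v : V, v ∈ R ∨ ∃ u ∈ R, G.Adj v u)
    (C : Finset V) (hC₁ : C ≠ ∅) (hC₂ : C ≠ Finset.univ)
    (hcut : cutCard G C < δ) :
    (R ∩ C).Nonempty ∧ (R \ C).Nonempty := by
  refine ⟨inter_nonempty_of_cutCard_lt G hdeg hdom (Finset.nonempty_iff_ne_empty.mpr hC₁) hcut, ?_⟩
  rw [Finset.sdiff_eq_inter_compl]
  refine inter_nonempty_of_cutCard_lt G hdeg hdom ?_ (by rwa [cutCard_compl])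
  rwa [Finset.nonempty_iff_ne_empty, Ne, Finset.compl_eq_empty_iff]
end

section
/- Every finite simple graph G on n ≥ 1 vertices in which every vertex has degree at least δ contains a dominating set R with |R| ≤ n·(1 + ln n)/(δ + 1). -/
/-- If every element of the nonempty set `U` is related to at least `d > 0` elements of `ι`, then
some element of `ι` is related to at least a proportion `d / |ι|` of `U`. -/
theorem exists_mul_card_le_card_mul_card_filter {α ι : Type*} [Fintype ι]
    (r : α → ι → Prop) [∀ a i, Decidable (r a i)] {d : ℕ} (hd : 0 < d) {U : Finset α}
    (hU : U.Nonempty) (h : ∀ a ∈ U, d ≤ (Finset.univ.filter (r a)).card) :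
    ∃ i, d * U.card ≤ Fintype.card ι * (U.filter (r · i)).card := by
  obtain ⟨a, ha⟩ := hU
  obtain ⟨j, -⟩ := Finset.card_pos.mp (hd.trans_le (h a ha))
  have hsum : ∑ _i : ι, d * U.card ≤ ∑ i, Fintype.card ι * (U.filter (r · i)).card := by
    rw [Finset.sum_const, ← Finset.mul_sum, Finset.card_univ, smul_eq_mul]
    refine Nat.mul_le_mul_left _ ?_
    have hcount := Finset.sum_card_bipartiteAbove_eq_sum_card_bipartiteBelow
      (s := U) (t := Finset.univ) r
    simp only [Finset.bipartiteAbove, Finset.bipartiteBelow] at hcount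
    rw [← hcount, mul_comm, ← smul_eq_mul]
    exact Finset.card_nsmul_le_sum _ _ _ h
  obtain ⟨i, -, hi⟩ := Finset.exists_le_of_sum_le ⟨j, Finset.mem_univ j⟩ hsum
  exact ⟨i, hi⟩

/-- The greedy set cover bound: if every element of the nonempty set `U` is related to at least
`d > 0` elements of `ι`, then `U` is covered by at most `|ι| / d * (1 + log |U|)` of them. -/
theorem exists_cover_card_le {α ι : Type*} [Fintype ι]
    (r : α → ι → Prop) [∀ a i, Decidable (r a i)] {d : ℕ} (hd : 0 < d) (U : Finset α)
    (hU : U.Nonempty) (h : ∀ a ∈ U, d ≤ (Finset.univ.filter (r a)).card) :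
    ∃ R : Finset ι, (∀ a ∈ U, ∃ i ∈ R, r a i) ∧
      (R.card : ℝ) ≤ (Fintype.card ι : ℝ) / d * (1 + Real.log U.card) := by
  classical
  induction U using Finset.strongInduction with
  | H U ih =>
  obtain ⟨i, hi⟩ := exists_mul_card_le_card_mul_card_filter r hd hU h
  have hUpos : 0 < U.card := hU.card_pos
  have hd' : (0 : ℝ) < d := by exact_mod_cast hd
  have hdι : d ≤ Fintype.card ι := by
    obtain ⟨a, ha⟩ := hU
    exact (h a ha).trans (Finset.card_le_univ _)
  have hratio : (1 : ℝ) ≤ (Fintype.card ι : ℝ) / d := by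
    rw [one_le_div hd']
    exact_mod_cast hdι
  have hsplit := Finset.card_filter_add_card_filter_not (s := U) (r · i)
  have hcovered : 0 < (U.filter (r · i)).card :=
    Nat.pos_of_mul_pos_left ((Nat.mul_pos hd hUpos).trans_le hi)
  rcases (U.filter (¬ r · i)).eq_empty_or_nonempty with hW | hW
  · refine ⟨{i}, fun a ha => ⟨i, Finset.mem_singleton_self i, ?_⟩, ?_⟩
    · by_contra hai
      exact Finset.notMem_empty a (hW ▸ Finset.mem_filter.mpr ⟨ha, hai⟩)
    · have hlog : 0 ≤ Real.log U.card := Real.log_natCast_nonneg _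
      rw [Finset.card_singleton, Nat.cast_one]
      nlinarith
  · have hlt : U.filter (¬ r · i) ⊂ U := by
      obtain ⟨a, ha⟩ := Finset.card_pos.mp hcovered
      rw [Finset.mem_filter] at ha
      exact Finset.filter_ssubset.mpr ⟨a, ha.1, not_not.mpr ha.2⟩
    obtain ⟨R, hR, hRcard⟩ := ih _ hlt hW fun a ha => h a (Finset.mem_filter.mp ha).1
    refine ⟨insert i R, fun a ha => ?_, ?_⟩
    · by_cases hai : r a i
      · exact ⟨i, Finset.mem_insert_self i R, hai⟩
      · obtain ⟨j, hj, haj⟩ := hR a (Finset.mem_filter.mpr ⟨ha, hai⟩)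
        exact ⟨j, Finset.mem_insert_of_mem hj, haj⟩
    · have hU' : (0 : ℝ) < U.card := by exact_mod_cast hUpos
      have hW' : (0 : ℝ) < (U.filter (¬ r · i)).card := by exact_mod_cast hW.card_pos
      have hsplit' : ((U.filter (r · i)).card : ℝ) + (U.filter (¬ r · i)).card = U.card := by
        exact_mod_cast hsplit
      have hi' : (d : ℝ) * U.card ≤ Fintype.card ι * (U.filter (r · i)).card := by
        exact_mod_cast hi
      have hlog := Real.log_le_sub_one_of_pos (div_pos hW' hU')
      rw [Real.log_div hW'.ne' hU'.ne'] at hlog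
      have hone : 1 ≤ (Fintype.card ι : ℝ) / d *
          (1 - ((U.filter (¬ r · i)).card : ℝ) / U.card) := by
        rw [one_sub_div hU'.ne', ← hsplit', add_sub_cancel_right, hsplit', div_mul_div_comm,
          one_le_div (mul_pos hd' hU')]
        exact hi'
      have hinsert : ((insert i R).card : ℝ) ≤ R.card + 1 := by
        exact_mod_cast Finset.card_insert_le i R
      nlinarith

/-- Every finite simple graph on `n ≥ 1` vertices with minimum degree
at least `δ` contains a dominating set `R` with `|R| ≤ n·(1 + ln n)/(δ + 1)`. -/
theorem exists_small_dominating_set {V : Type*} [Fintype V] [DecidableEq V]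
    (G : SimpleGraph V) [DecidableRel G.Adj] (n δ : ℕ)
    (hn : 1 ≤ n) (hcard : Fintype.card V = n)
    (hdeg : ∀ v : V, δ ≤ G.degree v) :
    ∃ R : Finset V, (∀ v : V, v ∈ R ∨ ∃ u ∈ R, G.Adj v u) ∧
      (R.card : ℝ) ≤ (n : ℝ) * (1 + Real.log n) / ((δ : ℝ) + 1) := by
  have hcover : ∀ v ∈ (Finset.univ : Finset V),
      δ + 1 ≤ (Finset.univ.filter fun u => u = v ∨ G.Adj v u).card := by
    intro v _
    have hclosed : (Finset.univ.filter fun u => u = v ∨ G.Adj v u) =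
        insert v (G.neighborFinset v) := by
      ext u
      simp
    rw [hclosed, Finset.card_insert_of_notMem (G.notMem_neighborFinset_self v),
      G.card_neighborFinset_eq_degree]
    exact Nat.succ_le_succ (hdeg v)
  have hne : (Finset.univ : Finset V).Nonempty := by
    rw [← Finset.card_pos, Finset.card_univ, hcard]
    exact hn
  obtain ⟨R, hR, hRcard⟩ :=
    exists_cover_card_le (fun v u => u = v ∨ G.Adj v u) δ.succ_pos Finset.univ hne hcover
  refine ⟨R, fun v => ?_, ?_⟩
  · obtain ⟨u, hu, rfl | huv⟩ := hR v (Finset.mem_univ v)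
    · exact Or.inl hu
    · exact Or.inr ⟨u, hu, huv⟩
  · rw [Finset.card_univ, hcard, Nat.cast_succ] at hRcard
    rwa [mul_div_right_comm]
end

section
/- Let G be a finite simple graph on vertex set V, let r ∈ V, and let T ⊆ V with r ∉ T. Let 𝓕 = {X ⊆ V : r ∈ X and X ∩ T = ∅}. Suppose X₀ ∈ 𝓕 is a closest minimum isolating cut for r, i.e., |∂_G X₀| ≤ |∂_G X| for every X ∈ 𝓕, and X₀ ⊆ X for every X ∈ 𝓕 with |∂_G X| = |∂_G X₀|. Then for every Y ⊆ V with r ∈ Y and |∂_G Y| ≤ |∂_G (X₀ ∪ Y)|, we have X₀ ⊆ Y. -/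
/-- The cut function of a graph is submodular. -/
theorem cutCard_inter_add_cutCard_union_le {V : Type*} [Fintype V] [DecidableEq V]
    (G : SimpleGraph V) [DecidableRel G.Adj] (A B : Finset V) :
    cutCard G (A ∩ B) + cutCard G (A ∪ B) ≤ cutCard G A + cutCard G B := by
  simp only [cutCard, Finset.card_filter, ← Finset.sum_add_distrib]
  refine Finset.sum_le_sum fun p _ => ?_
  simp only [Finset.mem_inter, Finset.mem_union]
  by_cases h₁ : p.1 ∈ A <;> by_cases h₂ : p.2 ∈ A <;> by_cases h₃ : p.1 ∈ B <;>
    by_cases h₄ : p.2 ∈ B <;> simp [h₁, h₂, h₃, h₄]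

/-- Let `X₀` be a closest minimum isolating cut for `r` with respect
to `T` (i.e. among sets containing `r` and disjoint from `T`, it minimizes the cut
size, and is contained in every other minimizer). Then for every `Y` with `r ∈ Y`
and `|∂_G Y| ≤ |∂_G (X₀ ∪ Y)|`, we have `X₀ ⊆ Y`. -/
theorem closest_min_isolating_cut_subset {V : Type*} [Fintype V] [DecidableEq V]
    (G : SimpleGraph V) [DecidableRel G.Adj]
    (r : V) (T : Finset V) (hrT : r ∉ T)
    (X₀ : Finset V) (hX₀r : r ∈ X₀) (hX₀T : Disjoint X₀ T)
    (hmin : ∀ X : Finset V, r ∈ X → Disjoint X T → cutCard G X₀ ≤ cutCard G X)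
    (hclosest : ∀ X : Finset V, r ∈ X → Disjoint X T →
      cutCard G X = cutCard G X₀ → X₀ ⊆ X)
    (Y : Finset V) (hY : r ∈ Y)
    (hcut : cutCard G Y ≤ cutCard G (X₀ ∪ Y)) :
    X₀ ⊆ Y := by
  have hr : r ∈ X₀ ∩ Y := Finset.mem_inter.2 ⟨hX₀r, hY⟩
  have hT : Disjoint (X₀ ∩ Y) T := hX₀T.mono_left Finset.inter_subset_left
  have hle := hmin _ hr hT
  have hsub := cutCard_inter_add_cutCard_union_le G X₀ Y
  exact (hclosest _ hr hT (by omega)).trans Finset.inter_subset_right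
end

section
/- Let G be a finite simple graph on vertex set V, let U ⊆ V, R' ⊆ U, let φ > 0 be a real number and τ ≥ 0 an integer. Suppose that for every S ⊆ U the number e_G(S, U \ S) of edges of G with one endpoint in S and the other in U \ S satisfies e_G(S, U \ S) ≥ φ·(τ+1)·min(|R' ∩ S|, |R' \ S|). Then for every C ⊆ V with |∂_G C| ≤ τ, we have min(|R' ∩ C|, |R' \ C|) ≤ τ / (φ·(τ+1)). -/
/-- For disjoint vertex sets `A`, `B`, the number of edges of `G` with one
endpoint in `A` and the other in `B`. -/
def eBetween {V : Type*} [Fintype V] [DecidableEq V] (G : SimpleGraph V)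
    [DecidableRel G.Adj] (A B : Finset V) : ℕ :=
  ((A ×ˢ B).filter (fun p : V × V => G.Adj p.1 p.2)).card

/-- If `U ⊆ V` with core `R' ⊆ U` satisfies the `(φ, τ)`-almost-expander
condition, then for every `C ⊆ V` with `|∂_G C| ≤ τ`,
`min(|R' ∩ C|, |R' \ C|) ≤ τ / (φ·(τ+1))`. -/
theorem almost_expander_unbalanced {V : Type*} [Fintype V] [DecidableEq V]
    (G : SimpleGraph V) [DecidableRel G.Adj]
    (U R' : Finset V) (hR'U : R' ⊆ U)
    (φ : ℝ) (hφ : 0 < φ) (τ : ℕ)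
    (hexp : ∀ S ⊆ U, φ * ((τ : ℝ) + 1) *
        min ((R' ∩ S).card : ℝ) ((R' \ S).card : ℝ) ≤ (eBetween G S (U \ S) : ℝ))
    (C : Finset V) (hC : cutCard G C ≤ τ) :
    min ((R' ∩ C).card : ℝ) ((R' \ C).card : ℝ) ≤ (τ : ℝ) / (φ * ((τ : ℝ) + 1)) := by
  have hcut : eBetween G (C ∩ U) (U \ (C ∩ U)) ≤ τ := by
    refine le_trans (Finset.card_le_card fun p hp => ?_) hC
    simp only [Finset.mem_filter, Finset.mem_product, Finset.mem_inter, Finset.mem_sdiff,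
      Finset.mem_univ, true_and] at hp ⊢
    tauto
  have hinter : R' ∩ (C ∩ U) = R' ∩ C := by
    rw [← Finset.inter_assoc,
      Finset.inter_eq_left.mpr (Finset.inter_subset_left.trans hR'U)]
  have hsdiff : R' \ (C ∩ U) = R' \ C := by
    rw [← Finset.sdiff_inter_self_left, hinter, Finset.sdiff_inter_self_left]
  have h := hexp (C ∩ U) Finset.inter_subset_right
  rw [hinter, hsdiff] at h
  rw [le_div_iff₀' (by positivity)]
  exact h.trans (by exact_mod_cast hcut)
end

section
/- Let G be a finite simple graph on vertex set V, let U ⊆ V, R' ⊆ U, let φ > 0 be a real number and τ ≥ 0 an integer, and suppose that for every S ⊆ U, e_G(S, U \ S) ≥ φ·(τ+1)·min(|R' ∩ S|, |R' \ S|). Let C ⊆ V be a set with |∂_G C| ≤ τ such that |R' ∩ C| ≥ 1 + 1/φ. Then |R' \ C| ≤ τ / (φ·(τ+1)); in particular |R' \ C| ≤ |R' ∩ C|. -/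
/-- The edges of `G` inside `U` that cross `C` are among the boundary edges of `C`. -/
theorem eBetween_inter_sdiff_le_cutCard {V : Type*} [Fintype V] [DecidableEq V]
    (G : SimpleGraph V) [DecidableRel G.Adj] (U C : Finset V) :
    eBetween G (U ∩ C) (U \ (U ∩ C)) ≤ cutCard G C := by
  unfold eBetween cutCard
  apply Finset.card_le_card
  intro p hp
  simp only [Finset.mem_filter, Finset.mem_product, Finset.mem_inter, Finset.mem_sdiff,
    Finset.mem_univ, true_and] at hp ⊢
  tauto

/-- If `U ⊆ V` with core `R' ⊆ U` satisfies the `(φ, τ)`-almost-expander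
condition and `C ⊆ V` has `|∂_G C| ≤ τ` and `|R' ∩ C| ≥ 1 + 1/φ`, then
`|R' \ C| ≤ τ / (φ·(τ+1))`; in particular `|R' \ C| ≤ |R' ∩ C|`. -/
theorem almost_expander_small_side {V : Type*} [Fintype V] [DecidableEq V]
    (G : SimpleGraph V) [DecidableRel G.Adj]
    (U R' : Finset V) (hR'U : R' ⊆ U)
    (φ : ℝ) (hφ : 0 < φ) (τ : ℕ)
    (hexp : ∀ S ⊆ U, φ * ((τ : ℝ) + 1) *
        min ((R' ∩ S).card : ℝ) ((R' \ S).card : ℝ) ≤ (eBetween G S (U \ S) : ℝ))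
    (C : Finset V) (hC : cutCard G C ≤ τ)
    (hbig : 1 + 1 / φ ≤ ((R' ∩ C).card : ℝ)) :
    ((R' \ C).card : ℝ) ≤ (τ : ℝ) / (φ * ((τ : ℝ) + 1)) ∧
      (R' \ C).card ≤ (R' ∩ C).card := by
  have hinter : R' ∩ (U ∩ C) = R' ∩ C := by
    rw [← Finset.inter_assoc, Finset.inter_eq_left.mpr hR'U]
  have hsdiff : R' \ (U ∩ C) = R' \ C := by
    rw [← Finset.sdiff_inter_self_left R' (U ∩ C), hinter, Finset.sdiff_inter_self_left]
  have hcut : (eBetween G (U ∩ C) (U \ (U ∩ C)) : ℝ) ≤ τ := by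
    exact_mod_cast (eBetween_inter_sdiff_le_cutCard G U C).trans hC
  have hmin := (hexp (U ∩ C) Finset.inter_subset_left).trans hcut
  rw [hinter, hsdiff] at hmin
  have hpos : 0 < φ * ((τ : ℝ) + 1) := by positivity
  have hmin_le : min ((R' ∩ C).card : ℝ) ((R' \ C).card : ℝ) ≤ τ / (φ * ((τ : ℝ) + 1)) := by
    rw [le_div_iff₀ hpos]
    linarith
  have hratio : (τ : ℝ) / (φ * ((τ : ℝ) + 1)) ≤ 1 / φ := by
    rw [div_le_div_iff₀ hpos hφ]
    linarith
  have hside : ((R' \ C).card : ℝ) ≤ τ / (φ * ((τ : ℝ) + 1)) := by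
    rcases min_le_iff.mp hmin_le with h | h
    · linarith
    · exact h
  refine ⟨hside, ?_⟩
  have hcard : ((R' \ C).card : ℝ) ≤ ((R' ∩ C).card : ℝ) := by linarith
  exact_mod_cast hcard
end

section
/- Let G be a finite simple graph on vertex set V, let τ ≥ 0 be an integer and φ > 0 a real number. Let R ⊆ V be φ-balanced, i.e., for every C with ∅ ≠ C ≠ V and |∂_G C| ≤ τ, min(|R ∩ C|, |R \ C|) > (1/φ)³ + 1/φ. Let V₁, …, V_k be a partition of V, let R_i = R ∩ V_i, and let R_i' ⊆ R_i be such that each V_i with core R_i' satisfies the (φ, τ)-almost-expander condition. Let R̃ ⊆ V satisfy: (i) R_i \ R_i' ⊆ R̃ for every i; (ii) R̃ ∩ R_i' ≠ ∅ for every i with 1 ≤ |R_i'| ≤ (1/φ)²; (iii) |R̃ ∩ R_i'| ≥ 1 + 1/φ for every i with |R_i'| > (1/φ)². Then R̃ is τ-separated: for every C with ∅ ≠ C ≠ V and |∂_G C| ≤ τ, both R̃ ∩ C and R̃ \ C are nonempty. -/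
/-- Edges crossing `C` inside disjoint parts are counted at most once by `cutCard G C`. -/
theorem sum_eBetween_le_cutCard {V ι : Type*} [Fintype V] [DecidableEq V] [Fintype ι]
    (G : SimpleGraph V) [DecidableRel G.Adj] (P : ι → Finset V)
    (hP : Pairwise fun i j => Disjoint (P i) (P j)) (C : Finset V) :
    ∑ i, eBetween G (C ∩ P i) (P i \ (C ∩ P i)) ≤ cutCard G C := by
  classical
  unfold eBetween cutCard
  rw [← Finset.card_biUnion]
  · refine Finset.card_le_card fun p hp => ?_
    simp only [Finset.mem_biUnion, Finset.mem_filter, Finset.mem_product, Finset.mem_inter,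
      Finset.mem_sdiff, Finset.mem_univ, true_and] at hp ⊢
    obtain ⟨i, h, hadj⟩ := hp
    exact ⟨h.1.1, fun hC => h.2.2 ⟨hC, h.2.1⟩, hadj⟩
  · intro i _ j _ hij
    refine Finset.disjoint_left.mpr ?_
    intro p hp hq
    simp only [Finset.mem_filter, Finset.mem_product, Finset.mem_inter] at hp hq
    exact Finset.disjoint_left.mp (hP hij) hp.1.1.2 hq.1.1.2

/-- If a small cut `C` contains many terminals, then it meets the sparsified set `Rt`. -/
theorem inter_nonempty_of_cutCard_le {V ι : Type*} [Fintype V] [DecidableEq V] [Fintype ι]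
    (G : SimpleGraph V) [DecidableRel G.Adj] (τ : ℕ) (φ : ℝ) (hφ : 0 < φ) (R : Finset V)
    (P : ι → Finset V) (hpart : ∀ v : V, ∃! i : ι, v ∈ P i)
    (R' : ι → Finset V) (hR' : ∀ i, R' i ⊆ R ∩ P i)
    (hexp : ∀ i, ∀ S ⊆ P i, φ * ((τ : ℝ) + 1) *
        min ((R' i ∩ S).card : ℝ) ((R' i \ S).card : ℝ) ≤ (eBetween G S (P i \ S) : ℝ))
    (Rt : Finset V)
    (h₁ : ∀ i, (R ∩ P i) \ R' i ⊆ Rt)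
    (h₂ : ∀ i, 1 ≤ (R' i).card → ((R' i).card : ℝ) ≤ (1 / φ) ^ 2 → (Rt ∩ R' i).Nonempty)
    (h₃ : ∀ i, (1 / φ) ^ 2 < ((R' i).card : ℝ) → 1 + 1 / φ ≤ ((Rt ∩ R' i).card : ℝ))
    (C : Finset V) (hC : cutCard G C ≤ τ)
    (hRC : (1 / φ) ^ 3 + 1 / φ < ((R ∩ C).card : ℝ)) : (Rt ∩ C).Nonempty := by
  by_contra hne
  have hdisj : ∀ v ∈ Rt, v ∉ C := fun v hv hvC => hne ⟨v, Finset.mem_inter.mpr ⟨hv, hvC⟩⟩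
  have hP : Pairwise fun i j => Disjoint (P i) (P j) := fun i j hij =>
    Finset.disjoint_left.mpr fun v hi hj => hij ((hpart v).unique hi hj)
  set s : ℝ := 1 / φ with hs
  have hs0 : 0 < s := by positivity
  set m : ι → ℝ := fun i => min ((R' i ∩ C).card : ℝ) ((R' i \ C).card : ℝ) with hm
  have hm0 : ∀ i, 0 ≤ m i := fun i => le_min (Nat.cast_nonneg _) (Nat.cast_nonneg _)
  have hexp' : ∀ i, φ * ((τ : ℝ) + 1) * m i ≤ (eBetween G (C ∩ P i) (P i \ (C ∩ P i)) : ℝ) := by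
    intro i
    have hsub : R' i ⊆ P i := (hR' i).trans Finset.inter_subset_right
    have e1 : R' i ∩ (C ∩ P i) = R' i ∩ C := by
      ext v
      have := @hsub v
      simp only [Finset.mem_inter]
      tauto
    have e2 : R' i \ (C ∩ P i) = R' i \ C := by
      ext v
      have := @hsub v
      simp only [Finset.mem_inter, Finset.mem_sdiff]
      tauto
    have h := hexp i (C ∩ P i) Finset.inter_subset_right
    rwa [e1, e2] at h
  have hsum : ∑ i, m i ≤ s := by
    have h1 : φ * ((τ : ℝ) + 1) * ∑ i, m i ≤ τ := by
      rw [Finset.mul_sum]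
      refine (Finset.sum_le_sum fun i _ => hexp' i).trans ?_
      exact_mod_cast (sum_eBetween_le_cutCard G P hP C).trans hC
    rw [hs, le_div_iff₀ hφ]
    by_contra! hlt
    have hτ : (0 : ℝ) < (τ : ℝ) + 1 := by positivity
    nlinarith [mul_lt_mul_of_pos_left hlt hτ]
  have hms : ∀ i, m i ≤ s := fun i =>
    (Finset.single_le_sum (fun j _ => hm0 j) (Finset.mem_univ i)).trans hsum
  have hRtsub : ∀ i, Rt ∩ R' i ⊆ R' i \ C := fun i v hv => by
    rw [Finset.mem_inter] at hv
    exact Finset.mem_sdiff.mpr ⟨hv.2, hdisj v hv.1⟩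
  have hbound : ∀ i, ((R' i ∩ C).card : ℝ) ≤ (s ^ 2 + 1) * m i := by
    intro i
    rcases le_or_gt ((R' i).card : ℝ) (s ^ 2) with hsmall | hlarge
    · rcases Finset.eq_empty_or_nonempty (R' i ∩ C) with he | hn
      · rw [he, Finset.card_empty, Nat.cast_zero]
        exact mul_nonneg (by positivity) (hm0 i)
      · have hpos : 1 ≤ (R' i ∩ C).card := hn.card_pos
        have hle : (R' i ∩ C).card ≤ (R' i).card := Finset.card_le_card Finset.inter_subset_left
        have hout : 1 ≤ (R' i \ C).card :=
          ((h₂ i (hpos.trans hle) hsmall).mono (hRtsub i)).card_pos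
        have hm1 : 1 ≤ m i := le_min (by exact_mod_cast hpos) (by exact_mod_cast hout)
        have hle' : ((R' i ∩ C).card : ℝ) ≤ (R' i).card := by exact_mod_cast hle
        nlinarith [sq_nonneg s]
    · have hout : 1 + s ≤ ((R' i \ C).card : ℝ) :=
        (h₃ i hlarge).trans (by exact_mod_cast Finset.card_le_card (hRtsub i))
      have heq : ((R' i ∩ C).card : ℝ) ≤ m i := by
        rcases min_choice ((R' i ∩ C).card : ℝ) ((R' i \ C).card : ℝ) with h | h
        · exact h.ge
        · linarith [hms i, show m i = ((R' i \ C).card : ℝ) from h]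
      nlinarith [mul_nonneg (sq_nonneg s) (hm0 i)]
  have hcover : R ∩ C ⊆ Finset.univ.biUnion fun i => R' i ∩ C := by
    intro v hv
    rw [Finset.mem_inter] at hv
    obtain ⟨i, hi, -⟩ := hpart v
    simp only [Finset.mem_biUnion, Finset.mem_univ, true_and, Finset.mem_inter]
    refine ⟨i, by_contra fun hnot => ?_, hv.2⟩
    exact hdisj v (h₁ i (Finset.mem_sdiff.mpr ⟨Finset.mem_inter.mpr ⟨hv.1, hi⟩, hnot⟩)) hv.2
  have hcard : ((R ∩ C).card : ℝ) ≤ ∑ i, ((R' i ∩ C).card : ℝ) := by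
    exact_mod_cast (Finset.card_le_card hcover).trans Finset.card_biUnion_le
  have hfin : ∑ i, ((R' i ∩ C).card : ℝ) ≤ (s ^ 2 + 1) * s := by
    refine (Finset.sum_le_sum fun i _ => hbound i).trans ?_
    rw [← Finset.mul_sum]
    gcongr
  nlinarith

/-- Suppose `R` is `φ`-balanced (every cut of size `≤ τ` has more than
`(1/φ)³ + 1/φ` terminals of `R` on each side), `V₁, …, V_k` is a partition of `V`
where each part `P i` with core `R' i ⊆ R ∩ P i` satisfies the `(φ, τ)`-almost-expander
condition, and `R̃` satisfies: (i) `(R ∩ P i) \ R' i ⊆ R̃`; (ii) `R̃` meets `R' i`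
whenever `1 ≤ |R' i| ≤ (1/φ)²`; (iii) `|R̃ ∩ R' i| ≥ 1 + 1/φ` whenever
`|R' i| > (1/φ)²`. Then `R̃` is `τ`-separated. -/
theorem sparsified_terminals_separated {V : Type*} [Fintype V] [DecidableEq V]
    (G : SimpleGraph V) [DecidableRel G.Adj]
    (τ : ℕ) (φ : ℝ) (hφ : 0 < φ)
    (R : Finset V)
    (hbal : ∀ C : Finset V, C ≠ ∅ → C ≠ Finset.univ → cutCard G C ≤ τ →
      (1 / φ) ^ 3 + 1 / φ < min ((R ∩ C).card : ℝ) ((R \ C).card : ℝ))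
    (k : ℕ) (P : Fin k → Finset V) (hpart : ∀ v : V, ∃! i : Fin k, v ∈ P i)
    (R' : Fin k → Finset V) (hR' : ∀ i, R' i ⊆ R ∩ P i)
    (hexp : ∀ i, ∀ S ⊆ P i, φ * ((τ : ℝ) + 1) *
        min ((R' i ∩ S).card : ℝ) ((R' i \ S).card : ℝ) ≤ (eBetween G S (P i \ S) : ℝ))
    (Rt : Finset V)
    (h₁ : ∀ i, (R ∩ P i) \ R' i ⊆ Rt)
    (h₂ : ∀ i, 1 ≤ (R' i).card → ((R' i).card : ℝ) ≤ (1 / φ) ^ 2 → (Rt ∩ R' i).Nonempty)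
    (h₃ : ∀ i, (1 / φ) ^ 2 < ((R' i).card : ℝ) → 1 + 1 / φ ≤ ((Rt ∩ R' i).card : ℝ)) :
    ∀ C : Finset V, C ≠ ∅ → C ≠ Finset.univ → cutCard G C ≤ τ →
      (Rt ∩ C).Nonempty ∧ (Rt \ C).Nonempty := by
  intro C hC₀ hC₁ hC
  have hR := lt_min_iff.mp (hbal C hC₀ hC₁ hC)
  have key := inter_nonempty_of_cutCard_le G τ φ hφ R P hpart R' hR' hexp Rt h₁ h₂ h₃
  refine ⟨key C hC hR.1, ?_⟩
  rw [Finset.sdiff_eq_inter_compl]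
  refine key Cᶜ ((cutCard_compl G C).le.trans hC) ?_
  rw [← Finset.sdiff_eq_inter_compl]
  exact hR.2
end

section
/- Let G be a finite simple graph on vertex set V, let τ ≥ 0 be an integer, and let φ > 0 and L ≥ 1 be real numbers. Let V₁, …, V_k be a partition of V such that |∂_G V_i| ≥ τ + 1 for every i, and let M be the number of edges of G whose endpoints lie in different parts. Let R ⊆ V, R_i = R ∩ V_i, and R_i' ⊆ R_i with |R_i \ R_i'| ≤ |R_i| / L for every i. Let R̃ ⊆ R satisfy, for every i: |R̃ ∩ R_i'| ≤ 1 if |R_i'| ≤ (1/φ)², and |R̃ ∩ R_i'| ≤ 1 + 1/φ if |R_i'| > (1/φ)². Then |R̃| ≤ |R|/L + 2M/(τ+1) + (φ + φ²)·|R|. -/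
theorem card_eq_sum_card_inter_parts {V ι : Type*} [DecidableEq V] [Fintype ι]
    {P : ι → Finset V} (hpart : ∀ v : V, ∃! i, v ∈ P i) (S : Finset V) :
    S.card = ∑ i, (S ∩ P i).card := by
  rw [← Finset.card_biUnion]
  · congr 1
    ext v
    obtain ⟨i, hi, -⟩ := hpart v
    simp only [Finset.mem_biUnion, Finset.mem_univ, true_and, Finset.mem_inter]
    exact ⟨fun h => ⟨i, h, hi⟩, fun ⟨_, h, _⟩ => h⟩
  · intro i _ j _ hij
    rw [Function.onFun, Finset.disjoint_left]
    intro v hvi hvj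
    exact hij ((hpart v).unique (Finset.mem_inter.1 hvi).2 (Finset.mem_inter.1 hvj).2)

/-- Each crossing edge is counted with both orientations on the right. -/
theorem sum_cutCard_le_card_crossing {V ι : Type*} [Fintype V] [DecidableEq V] [Fintype ι]
    (G : SimpleGraph V) [DecidableRel G.Adj]
    {P : ι → Finset V} (hpart : ∀ v : V, ∃! i, v ∈ P i) :
    ∑ i, cutCard G (P i) ≤ (Finset.univ.filter (fun p : V × V =>
      G.Adj p.1 p.2 ∧ ∀ i : ι, ¬(p.1 ∈ P i ∧ p.2 ∈ P i))).card := by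
  unfold cutCard
  rw [← Finset.card_biUnion]
  · refine Finset.card_le_card fun p hp => ?_
    simp only [Finset.mem_biUnion, Finset.mem_univ, true_and, Finset.mem_filter] at hp ⊢
    obtain ⟨i, h₁, h₂, hadj⟩ := hp
    refine ⟨hadj, fun j hj => h₂ ?_⟩
    rw [(hpart p.1).unique h₁ hj.1]
    exact hj.2
  · intro i _ j _ hij
    rw [Function.onFun, Finset.disjoint_left]
    intro p hpi hpj
    exact hij ((hpart p.1).unique (Finset.mem_filter.1 hpi).2.1 (Finset.mem_filter.1 hpj).2.1)

theorem card_parts_le_two_mul_div {V ι : Type*} [Fintype V] [DecidableEq V] [Fintype ι]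
    (G : SimpleGraph V) [DecidableRel G.Adj]
    {P : ι → Finset V} (hpart : ∀ v : V, ∃! i, v ∈ P i)
    {τ M : ℕ} (hbig : ∀ i, τ + 1 ≤ cutCard G (P i))
    (hM : 2 * M = (Finset.univ.filter (fun p : V × V =>
      G.Adj p.1 p.2 ∧ ∀ i : ι, ¬(p.1 ∈ P i ∧ p.2 ∈ P i))).card) :
    (Fintype.card ι : ℝ) ≤ 2 * (M : ℝ) / ((τ : ℝ) + 1) := by
  have h : Fintype.card ι * (τ + 1) ≤ 2 * M := by
    rw [hM]
    refine le_trans ?_ (sum_cutCard_le_card_crossing G hpart)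
    simpa using Finset.card_nsmul_le_sum Finset.univ _ _ fun i _ => hbig i
  rw [le_div_iff₀ (by positivity)]
  exact_mod_cast h

theorem le_one_add_mul_of_sparsified {φ r : ℝ} {c : ℕ} (hφ : 0 < φ) (hr : 0 ≤ r)
    (hsmall : r ≤ (1 / φ) ^ 2 → c ≤ 1) (hlarge : (1 / φ) ^ 2 < r → (c : ℝ) ≤ 1 + 1 / φ) :
    (c : ℝ) ≤ 1 + φ * r := by
  rcases le_or_gt r ((1 / φ) ^ 2) with h | h
  · have hc : (c : ℝ) ≤ 1 := by exact_mod_cast hsmall h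
    have := mul_nonneg hφ.le hr
    linarith
  · have hle : φ * (1 / φ) ^ 2 ≤ φ * r := by gcongr
    have heq : φ * (1 / φ) ^ 2 = 1 / φ := by field_simp
    linarith [hlarge h]

/-- Let `V₁, …, V_k` be a partition of `V` with `|∂_G V_i| ≥ τ + 1`
for each `i`, let `M` be the number of edges of `G` crossing between different
parts, let `R_i = R ∩ V_i` and `R' i ⊆ R_i` with `|R_i \ R' i| ≤ |R_i| / L`, and
let `R̃ ⊆ R` satisfy the per-part bounds `|R̃ ∩ R' i| ≤ 1` for small parts and
`|R̃ ∩ R' i| ≤ 1 + 1/φ` for large parts. Then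
`|R̃| ≤ |R|/L + 2M/(τ+1) + (φ + φ²)·|R|`. -/
theorem sparsified_terminals_size {V : Type*} [Fintype V] [DecidableEq V]
    (G : SimpleGraph V) [DecidableRel G.Adj]
    (τ : ℕ) (φ L : ℝ) (hφ : 0 < φ) (hL : 1 ≤ L)
    (k : ℕ) (P : Fin k → Finset V) (hpart : ∀ v : V, ∃! i : Fin k, v ∈ P i)
    (hbig : ∀ i, τ + 1 ≤ cutCard G (P i))
    (M : ℕ)
    (hM : 2 * M = (Finset.univ.filter (fun p : V × V =>
        G.Adj p.1 p.2 ∧ ∀ i : Fin k, ¬(p.1 ∈ P i ∧ p.2 ∈ P i))).card)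
    (R : Finset V) (R' : Fin k → Finset V) (hR' : ∀ i, R' i ⊆ R ∩ P i)
    (hloss : ∀ i, (((R ∩ P i) \ R' i).card : ℝ) ≤ ((R ∩ P i).card : ℝ) / L)
    (Rt : Finset V) (hRtR : Rt ⊆ R)
    (hsmall : ∀ i, ((R' i).card : ℝ) ≤ (1 / φ) ^ 2 → (Rt ∩ R' i).card ≤ 1)
    (hlarge : ∀ i, (1 / φ) ^ 2 < ((R' i).card : ℝ) →
      ((Rt ∩ R' i).card : ℝ) ≤ 1 + 1 / φ) :
    (Rt.card : ℝ) ≤ (R.card : ℝ) / L + 2 * (M : ℝ) / ((τ : ℝ) + 1)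
      + (φ + φ ^ 2) * (R.card : ℝ) := by
  have hpiece : ∀ i, ((Rt ∩ P i).card : ℝ)
      ≤ ((R ∩ P i).card : ℝ) / L + (1 + (φ + φ ^ 2) * ((R ∩ P i).card : ℝ)) := by
    intro i
    have hsub : Rt ∩ P i ⊆ ((R ∩ P i) \ R' i) ∪ (Rt ∩ R' i) := by
      intro v hv
      have := Finset.mem_inter.1 hv
      have := hRtR this.1
      by_cases v ∈ R' i <;> simp_all
    have hcard : ((Rt ∩ P i).card : ℝ)
        ≤ (((R ∩ P i) \ R' i).card : ℝ) + ((Rt ∩ R' i).card : ℝ) := by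
      exact_mod_cast (Finset.card_le_card hsub).trans (Finset.card_union_le _ _)
    have hkept := le_one_add_mul_of_sparsified hφ (Nat.cast_nonneg _) (hsmall i) (hlarge i)
    have hR'card : φ * ((R' i).card : ℝ) ≤ (φ + φ ^ 2) * ((R ∩ P i).card : ℝ) := by
      have := Finset.card_le_card (hR' i)
      gcongr
      exact le_add_of_nonneg_right (sq_nonneg φ)
    linarith [hloss i]
  have hk := card_parts_le_two_mul_div G hpart hbig (by convert hM)
  have hsum := Finset.sum_le_sum fun i (_ : i ∈ Finset.univ) => hpiece i
  have hR : (R.card : ℝ) = ∑ i, ((R ∩ P i).card : ℝ) := by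
    exact_mod_cast card_eq_sum_card_inter_parts hpart R
  have hRt : (Rt.card : ℝ) = ∑ i, ((Rt ∩ P i).card : ℝ) := by
    exact_mod_cast card_eq_sum_card_inter_parts hpart Rt
  rw [Finset.sum_add_distrib, Finset.sum_add_distrib, ← Finset.sum_div, ← Finset.mul_sum,
    ← hR, ← hRt, Finset.sum_const, Finset.card_univ, nsmul_eq_mul, mul_one] at hsum
  linarith
end

section
/- Let G be a connected finite simple graph on n vertices, let s and t be vertices of G with d = dist(s,t) ≥ 1. Then there exists a natural number j < d such that the set F of edges of G joining a vertex at distance j from s to a vertex at distance j+1 from s satisfies |F|·d² ≤ n², and every walk from s to t in G contains an edge of F (so removing F disconnects s from t). -/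
/-- Pairwise disjoint finite sets have total size at most that of the ambient type. -/
theorem sum_card_le_card_of_disjoint {V : Type*} [Fintype V] [DecidableEq V]
    (A : ℕ → Finset V) (S : Finset ℕ) (h : ∀ i j v, v ∈ A i → v ∈ A j → i = j) :
    ∑ j ∈ S, (A j).card ≤ Fintype.card V := by
  rw [← Finset.card_biUnion]
  · exact Finset.card_le_univ _
  · intro i _ j _ hij
    exact Finset.disjoint_left.mpr fun v hi hj => hij (h i j v hi hj)

/-- In a connected finite simple graph `G` on `n` vertices with
`d = dist(s,t) ≥ 1`, there exists `j < d` such that the set `F` of edges joining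
a vertex at distance `j` from `s` to a vertex at distance `j+1` from `s`
satisfies `|F|·d² ≤ n²`, and every walk from `s` to `t` contains an edge of `F`
(so removing `F` disconnects `s` from `t`). -/
theorem small_layer_cut {V : Type*} [Fintype V] [DecidableEq V]
    (G : SimpleGraph V) (hconn : G.Connected)
    (s t : V) (n d : ℕ) (hn : Fintype.card V = n)
    (hd : d = G.dist s t) (hd1 : 1 ≤ d) :
    ∃ j < d, ∃ F : Finset (Sym2 V),
      (∀ e : Sym2 V, e ∈ F ↔ e ∈ G.edgeSet ∧
        ∃ u v : V, e = s(u, v) ∧ G.dist s u = j ∧ G.dist s v = j + 1) ∧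
      F.card * d ^ 2 ≤ n ^ 2 ∧
      ∀ p : G.Walk s t, ∃ e ∈ F, e ∈ p.edges := by
  classical
  let A : ℕ → Finset V := fun j => Finset.univ.filter fun v => G.dist s v = j
  have hA : ∀ j v, v ∈ A j ↔ G.dist s v = j := by simp [A]
  obtain ⟨j, hj, hle⟩ : ∃ j ∈ Finset.range d,
      ((A j).card + (A (j + 1)).card) * d ≤ 2 * n := by
    apply Finset.exists_le_of_sum_le (Finset.nonempty_range_iff.mpr (by omega))
    have h₀ := sum_card_le_card_of_disjoint A (Finset.range d)
      (fun i j v hi hj => by rw [hA] at hi hj; omega)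
    have h₁ := sum_card_le_card_of_disjoint (fun j => A (j + 1)) (Finset.range d)
      (fun i j v hi hj => by rw [hA] at hi hj; omega)
    rw [← Finset.sum_mul, Finset.sum_add_distrib, Finset.sum_const, Finset.card_range,
      smul_eq_mul, mul_comm]
    exact Nat.mul_le_mul_left d (by omega)
  rw [Finset.mem_range] at hj
  let F : Finset (Sym2 V) := Finset.univ.filter fun e => e ∈ G.edgeSet ∧
    ∃ u v : V, e = s(u, v) ∧ G.dist s u = j ∧ G.dist s v = j + 1
  have hF : ∀ e : Sym2 V, e ∈ F ↔ e ∈ G.edgeSet ∧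
      ∃ u v : V, e = s(u, v) ∧ G.dist s u = j ∧ G.dist s v = j + 1 := by simp [F]
  refine ⟨j, hj, F, hF, ?_, fun p => ?_⟩
  · have hcard : F.card ≤ (A j).card * (A (j + 1)).card := by
      rw [← Finset.card_product]
      refine (Finset.card_le_card (t := (A j ×ˢ A (j + 1)).image fun x => s(x.1, x.2)) ?_).trans
        Finset.card_image_le
      intro e he
      obtain ⟨-, u, v, rfl, hu, hv⟩ := (hF e).mp he
      exact Finset.mem_image.mpr
        ⟨(u, v), Finset.mem_product.mpr ⟨(hA _ _).mpr hu, (hA _ _).mpr hv⟩, rfl⟩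
    have hsq := Nat.pow_le_pow_left hle 2
    have hamgm := four_mul_le_sq_add (A j).card (A (j + 1)).card
    have h₁ := Nat.mul_le_mul_right (d ^ 2) hcard
    have h₂ := Nat.mul_le_mul_right (d ^ 2) hamgm
    nlinarith
  · obtain ⟨a, ha, hin, hout⟩ := p.exists_boundary_dart {v | G.dist s v ≤ j}
      (by simp) (by simp only [Set.mem_ofPred_eq]; omega)
    simp only [Set.mem_ofPred_eq] at hin hout
    have htri := hconn.dist_triangle (u := s) (v := a.fst) (w := a.snd)
    rw [SimpleGraph.dist_eq_one_iff_adj.mpr a.adj] at htri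
    exact ⟨a.edge, (hF _).mpr ⟨a.edge_mem, a.fst, a.snd, rfl, by omega, by omega⟩,
      List.mem_map_of_mem ha⟩
end
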